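/- arXiv:2009.12802 — 4 statements merged into one kernel-verified Lean document; each statement's English description precedes it below -/
import Mathlib

section
/- A graph G has the strong parity property if and only if for every subset T of vertices, (sum over x in T of deg_G(x)) − 2|T| − c(G−T) ≥ −1, where c(G−T) is the number of connected components of G−T. -/
open scoped Classical

/-- A graph `G` has the strong parity property if for every vertex subset `X` of even
cardinality there is a spanning subgraph `F ≤ G` with minimum degree at least one in which
every vertex of `X` has odd degree and every other vertex has even degree. -/
def StrongParityProperty {V : Type*} [Fintype V] (G : SimpleGraph V) : Prop :=
  ∀ X : Finset V, Even X.card →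
    ∃ F : SimpleGraph V, F ≤ G ∧ (∀ v : V, 1 ≤ F.degree v) ∧
      (∀ v ∈ X, Odd (F.degree v)) ∧ (∀ v ∉ X, Even (F.degree v))

/-- `numComponents G T` is the number of connected components of `G - T`. -/
noncomputable def numComponents {V : Type*} [Fintype V] (G : SimpleGraph V) (T : Finset V) : ℕ :=
  Nat.card (G.induce ((↑T : Set V)ᶜ)).ConnectedComponent

namespace SimpleGraph

variable {V : Type*} [Fintype V]

/-- The sum of a weight function over the vertices of a component of `G - T`. -/
noncomputable def componentSum (G : SimpleGraph V) (T : Finset V) (h : V → ℕ)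
    (C : (G.induce ((↑T : Set V)ᶜ)).ConnectedComponent) : ℕ :=
  ∑ v with (G.induce ((↑T : Set V)ᶜ)).connectedComponentMk v = C, h v

theorem sum_componentSum (G : SimpleGraph V) (T : Finset V) (h : V → ℕ) :
    ∑ C, G.componentSum T h C = ∑ v ∈ Tᶜ, h v := by
  trans ∑ v : ((↑T : Set V)ᶜ : Set V), h v
  · unfold componentSum
    convert Finset.sum_fiberwise Finset.univ (G.induce ((↑T : Set V)ᶜ)).connectedComponentMk
      (fun v => h v)
  · exact (Finset.sum_subtype (Tᶜ) (p := fun v => v ∈ ((↑T : Set V)ᶜ)) (by simp) h).symm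

theorem even_card_iff_even_sum_add {G : SimpleGraph V} {T : Finset V} {h : V → ℕ} :
    Even (Finset.card {C | Odd (G.componentSum T h C)} + ∑ v ∈ T, h v) ↔ Even (∑ v, h v) := by
  rw [← Finset.sum_add_sum_compl T h, ← G.sum_componentSum T h, Nat.even_add, Nat.even_add,
    Finset.even_sum_iff_even_card_odd (G.componentSum T h)]
  exact iff_comm

/-- Degrees sum to an even number over any set of vertices closed under adjacency. -/
theorem even_sum_degree_of_closed (H : SimpleGraph V) (S : Finset V)
    (hS : ∀ u ∈ S, ∀ v, H.Adj u v → v ∈ S) : Even (∑ v ∈ S, H.degree v) := by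
  let K : SimpleGraph V :=
    { Adj := fun u v => H.Adj u v ∧ u ∈ S
      symm := ⟨fun u v ⟨h, hu⟩ => ⟨h.symm, hS u hu v h⟩⟩
      loopless := ⟨fun u h => H.loopless.irrefl u h.1⟩ }
  have hK : ∀ v, K.degree v = if v ∈ S then H.degree v else 0 := by
    intro v
    rw [← card_neighborFinset_eq_degree, ← card_neighborFinset_eq_degree]
    split_ifs with hv
    · congr 1; ext w; simp [K, hv]
    · rw [Finset.card_eq_zero]; ext w; simp [K, hv]
  have h := K.sum_degrees_eq_twice_card_edges
  simp only [hK, Finset.sum_ite_mem, Finset.univ_inter] at h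
  exact ⟨_, h.trans (two_mul _)⟩

theorem exists_le_degree_add_degree {F G : SimpleGraph V} (hF : F ≤ G) :
    ∃ H ≤ G, ∀ v, F.degree v + H.degree v = G.degree v := by
  refine ⟨G \ F, sdiff_le, fun v => ?_⟩
  simp only [← card_neighborFinset_eq_degree]
  rw [← Finset.card_union_of_disjoint]
  · congr 1
    ext w
    have := @hF v w
    simp only [Finset.mem_union, mem_neighborFinset, sdiff_adj]
    tauto
  · rw [Finset.disjoint_left]
    intro w
    simp only [mem_neighborFinset, sdiff_adj]
    tauto

/-- If a component of `G - T` has odd degree sum in `H ≤ G`, then `H` joins it to `T`. -/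
theorem exists_adj_of_odd_componentSum {G H : SimpleGraph V} (hH : H ≤ G) {T : Finset V}
    {C : (G.induce ((↑T : Set V)ᶜ)).ConnectedComponent}
    (hC : Odd (G.componentSum T (fun v => H.degree v) C)) :
    ∃ t ∈ T, ∃ u : ((↑T : Set V)ᶜ : Set V),
      (G.induce ((↑T : Set V)ᶜ)).connectedComponentMk u = C ∧ H.Adj t u := by
  by_contra! hno
  rw [← Nat.not_even_iff_odd] at hC
  apply hC
  have := H.even_sum_degree_of_closed
    ((Finset.univ.filter fun u => (G.induce ((↑T : Set V)ᶜ)).connectedComponentMk u = C).map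
      (Function.Embedding.subtype _)) (by
      simp only [Finset.mem_map, Finset.mem_filter, Finset.mem_univ, true_and,
        Function.Embedding.subtype_apply]
      rintro _ ⟨u, hu, rfl⟩ v huv
      have hv : v ∉ T := fun hv => hno v hv u hu huv.symm
      refine ⟨⟨v, by simpa using hv⟩, ?_, rfl⟩
      rw [← hu, ConnectedComponent.eq]
      exact Adj.reachable (by simpa using hH huv.symm))
  rwa [Finset.sum_map] at this

/-- The number of components of `G - T` with odd degree sum in `H ≤ G` is at most the degree
sum of `T` in `H`. -/
theorem card_odd_componentSum_le {G H : SimpleGraph V} (hH : H ≤ G) (T : Finset V) :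
    Finset.card {C | Odd (G.componentSum T (fun v => H.degree v) C)} ≤ ∑ t ∈ T, H.degree t := by
  simp only [← card_neighborFinset_eq_degree]
  rw [← Finset.card_sigma]
  have key : ∀ C : (G.induce ((↑T : Set V)ᶜ)).ConnectedComponent,
      ∃ p : Σ _ : V, V, Odd (G.componentSum T (fun v => H.degree v) C) →
        p ∈ T.sigma (fun t => H.neighborFinset t) ∧
        ∃ u : ((↑T : Set V)ᶜ : Set V), (G.induce ((↑T : Set V)ᶜ)).connectedComponentMk u = C ∧
          p.2 = u := by
    intro C
    by_cases hC : Odd (G.componentSum T (fun v => H.degree v) C)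
    · obtain ⟨t, ht, u, hu, hadj⟩ := exists_adj_of_odd_componentSum hH hC
      exact ⟨⟨t, u⟩, fun _ => ⟨by simp [ht, hadj], u, hu, rfl⟩⟩
    · obtain ⟨u, -⟩ := C.exists_rep
      exact ⟨⟨u, u⟩, fun h => absurd h hC⟩
  choose p hp using key
  refine Finset.card_le_card_of_injOn p (fun C hC => ?_) fun C hC D hD hCD => ?_
  · exact (hp C (Finset.mem_filter.1 hC).2).1
  · obtain ⟨-, u, hu, hu'⟩ := hp C (Finset.mem_filter.1 hC).2
    obtain ⟨-, w, hw, hw'⟩ := hp D (Finset.mem_filter.1 hD).2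
    rw [← hu, ← hw, Subtype.ext (hu'.symm.trans ((congrArg Sigma.snd hCD).trans hw'))]

/-- The graph obtained from `G` by replacing each vertex `v` by a clique on `h v` vertices and
each edge by a complete bipartite graph. -/
def cliqueBlowup (G : SimpleGraph V) (h : V → ℕ) : SimpleGraph (Σ v, Fin (h v)) where
  Adj a b := a ≠ b ∧ (a.1 = b.1 ∨ G.Adj a.1 b.1)
  symm := ⟨fun _ _ hab => ⟨hab.1.symm, hab.2.imp Eq.symm Adj.symm⟩⟩
  loopless := ⟨fun _ ha => ha.1 rfl⟩

theorem even_card_of_involution {α : Type*} (s : Finset α) (f : α → α) (hf : ∀ a, f (f a) = a)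
    (hne : ∀ a, f a ≠ a) (hs : ∀ a ∈ s, f a ∈ s) : Even s.card := by
  have h : ∑ _a ∈ s, (1 : ZMod 2) = 0 :=
    Finset.sum_involution (fun a _ => f a) (fun _ _ => by decide) (fun a _ _ => hne a) hs
      (fun a _ => hf a)
  rw [Finset.sum_const, nsmul_one] at h
  exact (ZMod.natCast_eq_zero_iff_even).1 h

/-- A perfect matching of the blow-up yields a subgraph of `G` by keeping the edges that it
uses an odd number of times. -/
theorem exists_subgraph_of_isPerfectMatching {G : SimpleGraph V} {h : V → ℕ}
    {M : (G.cliqueBlowup h).Subgraph} (hM : M.IsPerfectMatching) :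
    ∃ H ≤ G, ∀ v, H.degree v ≤ h v ∧ (Even (H.degree v) ↔ Even (h v)) := by
  rw [Subgraph.isPerfectMatching_iff] at hM
  choose f hadj huniq using hM
  have hf : ∀ a, f (f a) = a := fun a => (huniq _ _ (hadj a).symm).symm
  have hne : ∀ a, f a ≠ a := fun a ha => (hadj a).ne ha.symm
  let n : V → V → ℕ := fun u v => Finset.card {a : Σ v, Fin (h v) | a.1 = u ∧ (f a).1 = v}
  have hsymm : ∀ u v, n u v = n v u := by
    intro u v
    refine Finset.card_nbij' f f ?_ ?_ ?_ ?_
    · intro a; simp only [Finset.coe_filter, Finset.mem_univ, true_and, Set.mem_ofPred_eq, hf]; tauto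
    · intro a; simp only [Finset.coe_filter, Finset.mem_univ, true_and, Set.mem_ofPred_eq, hf]; tauto
    · exact fun a _ => hf a
    · exact fun a _ => hf a
  have hself : ∀ v, Even (n v v) := by
    intro v
    refine even_card_of_involution _ f hf hne fun a => ?_
    simp only [Finset.mem_filter, Finset.mem_univ, true_and, hf]
    tauto
  have hsum : ∀ v, ∑ w, n v w = h v := by
    intro v
    have h1 : Finset.card {a : Σ v, Fin (h v) | a.1 = v} = h v := by
      rw [← Fintype.card_subtype, Fintype.card_congr (Equiv.sigmaSubtype v), Fintype.card_fin]
    rw [← h1, Finset.card_eq_sum_card_fiberwise (f := fun a => (f a).1) (t := Finset.univ)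
      (by intro; simp)]
    simp only [n, Finset.filter_filter]
  let H : SimpleGraph V :=
    { Adj := fun u v => u ≠ v ∧ Odd (n u v)
      symm := ⟨fun u v huv => ⟨huv.1.symm, hsymm u v ▸ huv.2⟩⟩
      loopless := ⟨fun _ hu => hu.1 rfl⟩ }
  have hdeg : ∀ v [Fintype (H.neighborSet v)], H.degree v = Finset.card {w | Odd (n v w)} := by
    intro v _
    rw [← card_neighborFinset_eq_degree]
    congr 1
    ext w
    simp only [mem_neighborFinset, Finset.mem_filter, Finset.mem_univ, true_and, H, ne_eq,
      and_iff_right_iff_imp]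
    rintro hw rfl
    exact Nat.not_even_iff_odd.2 hw (hself v)
  refine ⟨H, fun u v huv => ?_, fun v => ⟨?_, ?_⟩⟩
  · obtain ⟨a, ha⟩ := Finset.card_pos.1 huv.2.pos
    simp only [Finset.mem_filter, Finset.mem_univ, true_and] at ha
    obtain ⟨rfl, rfl⟩ := ha
    exact (M.adj_sub (hadj a)).2.resolve_left huv.1
  · rw [hdeg, ← hsum, Finset.card_filter]
    refine Finset.sum_le_sum fun w _ => ?_
    split_ifs with hw
    · exact hw.pos
    · exact Nat.zero_le _
  · rw [hdeg, ← hsum v, Finset.even_sum_iff_even_card_odd]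

theorem odd_componentSum_le (G : SimpleGraph V) (T : Finset V) (h k s : V → ℕ)
    (hks : ∀ v, k v + s v = h v) :
    Finset.card {C | Odd (G.componentSum T k C)} ≤
      Finset.card {C | Odd (G.componentSum T h C)} + ∑ v ∈ Tᶜ, s v := by
  rw [← G.sum_componentSum, Finset.card_filter, Finset.card_filter, ← Finset.sum_add_distrib]
  refine Finset.sum_le_sum fun C _ => ?_
  have : G.componentSum T k C + G.componentSum T s C = G.componentSum T h C := by
    unfold componentSum
    rw [← Finset.sum_add_distrib]
    exact Finset.sum_congr rfl fun v _ => hks v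
  grind

/-- Deleting `S` from the blow-up leaves at most as many odd components as there are components
of `G - T` with an odd number of remaining vertices, where `T` is the set of vertices all of
whose copies lie in `S`. -/
theorem ncard_oddComponents_cliqueBlowup_le (G : SimpleGraph V) (h : V → ℕ)
    (S : Set (Σ v, Fin (h v))) (T : Finset V)
    (hT : ∀ v, v ∈ T ↔ ∀ i, (⟨v, i⟩ : Σ v, Fin (h v)) ∈ S) :
    ((⊤ : (G.cliqueBlowup h).Subgraph).deleteVerts S).coe.oddComponents.ncard ≤
      Finset.card {C | Odd (G.componentSum T
        (fun v => Finset.card {i : Fin (h v) | (⟨v, i⟩ : Σ v, Fin (h v)) ∉ S}) C)} := by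
  let K := ((⊤ : (G.cliqueBlowup h).Subgraph).deleteVerts S).coe
  let L := G.induce ((↑T : Set V)ᶜ)
  have hS : ∀ a : ((⊤ : (G.cliqueBlowup h).Subgraph).deleteVerts S).verts, a.1 ∉ S :=
    fun a => a.2.2
  let r : ((⊤ : (G.cliqueBlowup h).Subgraph).deleteVerts S).verts → ((↑T : Set V)ᶜ : Set V) :=
    fun a => ⟨a.1.1, by
      simp only [Set.mem_compl_iff, Finset.mem_coe, hT]
      exact fun hall => hS a (hall a.1.2)⟩
  have hKadj : ∀ a b, K.Adj a b ↔ (G.cliqueBlowup h).Adj a.1 b.1 := by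
    intro a b
    have := hS a
    have := hS b
    simp_all [K]
  have hdown : ∀ a b, K.Reachable a b → L.Reachable (r a) (r b) := by
    rintro a b ⟨p⟩
    induction p with
    | nil => rfl
    | cons hab _ ih =>
      refine Reachable.trans ?_ ih
      rcases ((hKadj _ _).1 hab).2 with heq | hadj
      · rw [show r _ = r _ from Subtype.ext heq]
      · exact Adj.reachable (by simpa [L, r] using hadj)
  have hup' : ∀ x y, L.Reachable x y → ∀ a b, r a = x → r b = y → K.Reachable a b := by
    rintro x y ⟨p⟩
    induction p with
    | nil =>
      rintro a b rfl hb
      by_cases hab : a = b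
      · rw [hab]
      · refine Adj.reachable ((hKadj _ _).2 ⟨fun h => hab (Subtype.ext h), Or.inl ?_⟩)
        exact (congrArg Subtype.val hb).symm
    | @cons x y z hxy _ ih =>
      rintro a b rfl rfl
      have hy : (y : V) ∉ T := y.2
      rw [hT] at hy
      push Not at hy
      obtain ⟨i, hi⟩ := hy
      let c : ((⊤ : (G.cliqueBlowup h).Subgraph).deleteVerts S).verts := ⟨⟨y, i⟩, by simpa using hi⟩
      refine Reachable.trans (Adj.reachable ((hKadj a c).2 ?_)) (ih c b rfl rfl)
      have hxy' : G.Adj a.1.1 y := by simpa [L, r] using hxy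
      exact ⟨fun h => hxy'.ne (congrArg Sigma.fst h), Or.inr hxy'⟩
  have hiff : ∀ a b, K.Reachable a b ↔ L.Reachable (r a) (r b) := fun a b =>
    ⟨hdown a b, fun hr => hup' _ _ hr a b rfl rfl⟩
  let π : K.ConnectedComponent → L.ConnectedComponent := fun C => L.connectedComponentMk (r C.out)
  have hπ : ∀ C a, K.connectedComponentMk a = C ↔ L.connectedComponentMk (r a) = π C := by
    intro C a
    rw [ConnectedComponent.eq, ← hiff, ← ConnectedComponent.eq]
    change _ ↔ _ = Quot.mk _ C.out
    rw [C.out_eq]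
    rfl
  have hinj : Function.Injective π := by
    intro C D hCD
    have h1 := (hπ C C.out).1 C.out_eq
    rw [hCD, ← hπ] at h1
    exact C.out_eq.symm.trans h1
  have hcard : ∀ C : K.ConnectedComponent, C.supp.ncard = G.componentSum T
      (fun v => Finset.card {i : Fin (h v) | (⟨v, i⟩ : Σ v, Fin (h v)) ∉ S}) (π C) := by
    intro C
    unfold componentSum
    rw [Set.ncard_eq_toFinset_card', Finset.card_eq_sum_card_fiberwise (f := r)
      (t := {v | L.connectedComponentMk v = π C})]
    · refine Finset.sum_congr rfl fun v hv => ?_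
      simp only [Finset.mem_filter, Finset.mem_univ, true_and] at hv
      symm
      refine Finset.card_bij (fun i hi => ⟨⟨v, i⟩, by simpa using hi⟩) ?_ ?_ ?_
      · intro i hi
        simp only [Finset.mem_filter, Set.mem_toFinset, ConnectedComponent.mem_supp_iff]
        exact ⟨(hπ _ _).2 hv, rfl⟩
      · intro i _ j _ hij
        simpa using hij
      · rintro ⟨⟨w, j⟩, hj⟩ hb
        obtain rfl : w = v := congrArg Subtype.val (Finset.mem_filter.1 hb).2
        exact ⟨j, by simpa using hj, rfl⟩
    · intro a ha
      simpa using (hπ C a).1 (by simpa using ha)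
  rw [← Set.ncard_coe_finset]
  refine Set.ncard_le_ncard_of_injOn π (fun C hC => ?_) hinj.injOn
  simpa [← hcard] using hC

/-- If for every `T` the graph `G - T` has at most `∑ v ∈ T, h v` components of odd total
weight, then `G` has a spanning subgraph with degrees at most `h` and of the parity of `h`. -/
theorem exists_subgraph_degree_parity (G : SimpleGraph V) (h : V → ℕ)
    (hG : ∀ T : Finset V, Finset.card {C | Odd (G.componentSum T h C)} ≤ ∑ v ∈ T, h v) :
    ∃ H ≤ G, ∀ v, H.degree v ≤ h v ∧ (Even (H.degree v) ↔ Even (h v)) := by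
  suffices hM : ∃ M : (G.cliqueBlowup h).Subgraph, M.IsPerfectMatching from
    hM.elim fun _ hM => exists_subgraph_of_isPerfectMatching hM
  rw [tutte]
  intro S
  rw [IsTutteViolator, not_lt]
  let T : Finset V := {v | ∀ i, (⟨v, i⟩ : Σ v, Fin (h v)) ∈ S}
  let s : V → ℕ := fun v => Finset.card {i : Fin (h v) | (⟨v, i⟩ : Σ v, Fin (h v)) ∈ S}
  have hsT : ∀ v ∈ T, s v = h v := by
    intro v hv
    have hv' : ∀ i, (⟨v, i⟩ : Σ v, Fin (h v)) ∈ S := by simpa [T] using hv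
    simp [s, hv']
  have hS : S.ncard = ∑ v, s v := by
    rw [Set.ncard_eq_toFinset_card', ← Finset.card_sigma]
    congr 1
    ext a
    simp
  calc _ ≤ _ := G.ncard_oddComponents_cliqueBlowup_le h S T (by simp [T])
    _ ≤ _ := G.odd_componentSum_le T h _ s fun v => by
      rw [add_comm, Finset.card_filter_add_card_filter_not, Finset.card_univ, Fintype.card_fin]
    _ ≤ ∑ v ∈ T, s v + ∑ v ∈ Tᶜ, s v := by
      rw [Finset.sum_congr rfl hsT]
      exact Nat.add_le_add_right (hG T) _
    _ = S.ncard := by rw [hS, Finset.sum_add_sum_compl]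

end SimpleGraph

section

open SimpleGraph

variable {V : Type*} [Fintype V]

theorem numComponents_eq_card (G : SimpleGraph V) (T : Finset V) :
    numComponents G T = Fintype.card (G.induce ((↑T : Set V)ᶜ)).ConnectedComponent :=
  Nat.card_eq_fintype_card

theorem StrongParityProperty.numComponents_le {G : SimpleGraph V} (hG : StrongParityProperty G)
    (T : Finset V) : numComponents G T + 2 * T.card ≤ ∑ x ∈ T, G.degree x + 1 := by
  let r : (G.induce ((↑T : Set V)ᶜ)).ConnectedComponent → V := fun C => C.out
  have hr : ∀ C, (G.induce ((↑T : Set V)ᶜ)).connectedComponentMk C.out = C := fun C => C.out_eq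
  have hrT : ∀ C, r C ∉ T := fun C => C.out.2
  let E : Finset (G.induce ((↑T : Set V)ᶜ)).ConnectedComponent :=
    {C | Even (G.componentSum T (fun v => G.degree v) C)}
  obtain ⟨D, hDE, hD, hcard⟩ : ∃ D ⊆ E, Even D.card ∧ (E \ D).card ≤ 1 := by
    rcases Nat.even_or_odd E.card with hE | hE
    · exact ⟨E, subset_rfl, hE, by simp⟩
    · obtain ⟨C, hC⟩ := Finset.card_pos.1 hE.pos
      refine ⟨E.erase C, Finset.erase_subset _ _, ?_, ?_⟩
      · rw [Finset.card_erase_of_mem hC]; exact Nat.Odd.sub_odd hE odd_one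
      · simp [Finset.sdiff_erase hC]
  have hrinj : Function.Injective r := fun C C' h => by
    rw [← hr C, ← hr C', Subtype.ext h]
  obtain ⟨F, hFG, hpos, hodd, heven⟩ := hG (D.image r) (by
     rwa [Finset.card_image_of_injective _ hrinj])
  obtain ⟨H, hHG, hdeg⟩ := exists_le_degree_add_degree hFG
  have hsub : ∀ C, C ∉ E \ D → Odd (G.componentSum T (fun v => H.degree v) C) := by
    intro C hC
    have hsum : G.componentSum T (fun v => F.degree v) C +
        G.componentSum T (fun v => H.degree v) C =
        G.componentSum T (fun v => G.degree v) C := by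
      unfold componentSum
      rw [← Finset.sum_add_distrib]
      exact Finset.sum_congr rfl fun v _ => hdeg v
    have hF : Odd (G.componentSum T (fun v => F.degree v) C) ↔ C ∈ D := by
      unfold componentSum
      rw [Finset.odd_sum_iff_odd_card_odd, Finset.filter_filter]
      have hv : ∀ v : ((↑T : Set V)ᶜ : Set V), ((G.induce ((↑T : Set V)ᶜ)).connectedComponentMk v = C ∧
          Odd (F.degree v)) ↔ (v = C.out ∧ C ∈ D) := by
        intro v
        constructor
        · rintro ⟨h1, h2⟩
          have : (v : V) ∈ D.image r := by
            by_contra hn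
            exact Nat.not_even_iff_odd.2 h2 (heven _ hn)
          obtain ⟨C', hC', h3⟩ := Finset.mem_image.1 this
          have h4 : C'.out = v := Subtype.ext h3
          have h5 : C' = C := by rw [← hr C', h4, h1]
          subst h5
          exact ⟨h4.symm, hC'⟩
        · rintro ⟨rfl, h⟩
          exact ⟨hr C, hodd _ (Finset.mem_image_of_mem r h)⟩
      simp only [hv]
      by_cases hCD : C ∈ D
      · simp [hCD, Finset.filter_eq']
      · simp [hCD]
    have hCE : C ∈ E ↔ Even (G.componentSum T (fun v => G.degree v) C) := by simp [E]
    have hDE' := @hDE C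
    rw [Finset.mem_sdiff] at hC
    rw [← hsum] at hCE
    by_cases hCD : C ∈ D
    · have h1 := hF.2 hCD
      have h2 := hCE.1 (hDE' hCD)
      grind
    · have h1 := mt hF.1 hCD
      have h2 := mt hCE.2 (fun h => hC ⟨h, hCD⟩)
      grind
  have h1 := card_odd_componentSum_le hHG T
  have h2 : (E \ D)ᶜ.card ≤
      Finset.card {C | Odd (G.componentSum T (fun v => H.degree v) C)} :=
    Finset.card_le_card fun C hC => by
      simpa using hsub C (Finset.mem_compl.1 hC)
  rw [Finset.card_compl, ← numComponents_eq_card] at h2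
  have h3 : ∑ t ∈ T, (H.degree t + 2) ≤ ∑ t ∈ T, G.degree t := by
    refine Finset.sum_le_sum fun t ht => ?_
    have h4 := hdeg t
    have h5 := hpos t
    have h6 : Even (F.degree t) := heven t fun h => by
      obtain ⟨C, -, hC⟩ := Finset.mem_image.1 h
      exact hrT C (hC ▸ ht)
    grind
  simp only [Finset.sum_add_distrib, Finset.sum_const, smul_eq_mul] at h3
  omega

theorem strongParityProperty_of_numComponents_le {G : SimpleGraph V}
    (hG : ∀ T : Finset V, numComponents G T + 2 * T.card ≤ ∑ x ∈ T, G.degree x + 1) :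
    StrongParityProperty G := by
  intro X hX
  have hdeg : ∀ v, 2 ≤ G.degree v := by
    intro v
    have h := hG {v}
    simp only [Finset.card_singleton, Finset.sum_singleton] at h
    by_contra hlt
    have h1 : G.degree v = 1 := by omega
    have h0 : numComponents G {v} = 0 := by omega
    obtain ⟨w, hw⟩ := (G.degree_pos_iff_exists_adj v).1 (by omega)
    rw [numComponents_eq_card, Fintype.card_eq_zero_iff] at h0
    exact h0.elim (connectedComponentMk _ ⟨w, by simpa using hw.ne'⟩)
  let g : V → ℕ := fun v => if v ∈ X then 1 else 2
  have hg : ∀ v, g v ≤ 2 ∧ 1 ≤ g v ∧ (v ∈ X → g v = 1) ∧ (v ∉ X → g v = 2) := by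
    intro v
    by_cases hv : v ∈ X <;> simp [g, hv]
  let h : V → ℕ := fun v => G.degree v - g v
  have hh : ∀ v, h v + g v = G.degree v := fun v =>
    Nat.sub_add_cancel ((hg v).1.trans (hdeg v))
  have heven : Even (∑ v, h v) := by
    have h1 : ∑ v, h v + ∑ v, g v = ∑ v, G.degree v := by
      rw [← Finset.sum_add_distrib]
      exact Finset.sum_congr rfl fun v _ => hh v
    rw [G.sum_degrees_eq_twice_card_edges] at h1
    have h2 : Even (∑ v, g v) := by
      rw [Finset.even_sum_iff_even_card_odd]
      convert hX using 2
      ext v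
      by_cases hv : v ∈ X <;> simp [g, hv]
    grind
  obtain ⟨H, hHG, hH⟩ := G.exists_subgraph_degree_parity h (by
    intro T
    have h1 := (even_card_iff_even_sum_add (G := G) (T := T) (h := h)).2 heven
    have h2 : Finset.card {C | Odd (G.componentSum T h C)} ≤ numComponents G T := by
      rw [numComponents_eq_card]
      exact Finset.card_le_univ _
    have h3 : ∑ x ∈ T, G.degree x ≤ ∑ x ∈ T, (h x + 2) :=
      Finset.sum_le_sum fun x _ => by have := hh x; have := (hg x).1; omega
    simp only [Finset.sum_add_distrib, Finset.sum_const, smul_eq_mul] at h3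
    have h4 := hG T
    rw [Nat.even_iff] at h1
    omega)
  obtain ⟨F, hFG, hdegF⟩ := exists_le_degree_add_degree hHG
  have hF : ∀ v, H.degree v + F.degree v = h v + g v := fun v =>
    (hdegF v).trans (hh v).symm
  refine ⟨F, hFG, fun v => ?_, fun v hv => ?_, fun v hv => ?_⟩
  · have := hF v; have := hH v; have := hg v; omega
  · have := hF v; have := hH v; have := (hg v).2.2.1 hv; grind
  · have := hF v; have := hH v; have := (hg v).2.2.2 hv; grind

end

theorem strong_parity_characterization {V : Type*} [Fintype V] (G : SimpleGraph V) :
    StrongParityProperty G ↔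
      ∀ T : Finset V,
        (∑ x ∈ T, (G.degree x : ℤ)) - 2 * T.card - numComponents G T ≥ -1 := by
  have hT : ∀ T : Finset V,
      (∑ x ∈ T, (G.degree x : ℤ)) - 2 * T.card - numComponents G T ≥ -1 ↔
        numComponents G T + 2 * T.card ≤ ∑ x ∈ T, G.degree x + 1 := by
    intro T
    rw [← Nat.cast_sum]
    omega
  simp only [hT]
  exact ⟨fun h => h.numComponents_le, strongParityProperty_of_numComponents_le⟩
end

section
/- Every 3-edge-connected graph with minimum degree at least three has the strong parity property. -/
open scoped Classical

/-- `G` is 3-edge-connected: deleting any set of at most two edges leaves it connected. -/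
def ThreeEdgeConnected {V : Type*} (G : SimpleGraph V) : Prop :=
  ∀ s : Set (Sym2 V), s.ncard ≤ 2 → (G.deleteEdges s).Connected

namespace SimpleGraph

/-- If every neighbourhood is covered by three cliques (the fibres of `label`) and every union `S` of
components of `H - U`, other than all of `H - U`, has at least three neighbours in `U`, then `H` has a
perfect matching. -/
lemma exists_isPerfectMatching_of_three_le_ncard {W : Type*} [Fintype W] (H : SimpleGraph W)
    (heven : Even (Nat.card W)) (label : W → W → Fin 3)
    (hclique : ∀ u a b, H.Adj u a → H.Adj u b → label u a = label u b → a = b ∨ H.Adj a b)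
    (hnbr : ∀ U S : Set W, S.Nonempty → Disjoint S U →
      (∀ a ∈ S, ∀ b ∉ U, H.Adj a b → b ∈ S) → S = Uᶜ ∨ 3 ≤ {u ∈ U | ∃ a ∈ S, H.Adj u a}.ncard) :
    ∃ M : H.Subgraph, M.IsPerfectMatching := by
  refine tutte.2 fun U hU ↦ ?_
  rw [IsTutteViolator] at hU
  set K := ((⊤ : H.Subgraph).deleteVerts U).coe with hK
  have hKadj : ∀ a b, K.Adj a b ↔ H.Adj a.1 b.1 := by
    rintro ⟨a, ha⟩ ⟨b, hb⟩
    simp only [Subgraph.verts_top, Subgraph.deleteVerts_verts, Set.mem_sdiff, Set.mem_univ,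
      true_and] at ha hb
    simp [hK, ha, hb]
  have hmem : ∀ a, a ∈ ((⊤ : H.Subgraph).deleteVerts U).verts ↔ a ∉ U := by simp
  have hclosed : ∀ c : K.ConnectedComponent, Subtype.val '' c.supp = Uᶜ ∨
      3 ≤ {u ∈ U | ∃ a ∈ Subtype.val '' c.supp, H.Adj u a}.ncard := by
    intro c
    refine hnbr _ _ (c.nonempty_supp.image _) ?_ ?_
    · rw [Set.disjoint_left]
      rintro _ ⟨a, -, rfl⟩
      exact (hmem _).1 a.2
    · rintro _ ⟨a, ha, rfl⟩ b hb hab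
      exact ⟨⟨b, (hmem b).2 hb⟩, c.mem_supp_of_adj_mem_supp ha ((hKadj _ _).2 hab), rfl⟩
  by_cases hall : ∃ c : K.ConnectedComponent, Subtype.val '' c.supp = Uᶜ
  · obtain ⟨c, hc⟩ := hall
    have hsub : ∀ c' : K.ConnectedComponent, c' = c := by
      intro c'
      obtain ⟨x, hx⟩ := c'.nonempty_supp
      have : x.1 ∈ Subtype.val '' c.supp := hc ▸ (hmem _).1 x.2
      obtain ⟨y, hy, hyx⟩ := this
      obtain rfl := Subtype.ext hyx
      rw [ConnectedComponent.mem_supp_iff] at hx hy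
      rw [← hx, ← hy]
    have hle : K.oddComponents.ncard ≤ 1 :=
      (Set.ncard_le_one (Set.toFinite _)).2 fun a _ b _ ↦ (hsub a).trans (hsub b).symm
    have hU0 : U = ∅ := (Set.ncard_eq_zero (Set.toFinite U)).1 (by omega)
    have hone : K.oddComponents.ncard = 1 := by omega
    have hodd := K.odd_ncard_oddComponents.1 (hone ▸ odd_one)
    rw [Nat.card_congr (Equiv.subtypeUnivEquiv fun a ↦ (hmem a).2 (by simp [hU0]))] at hodd
    exact Nat.not_odd_iff_even.2 heven hodd
  · push Not at hall
    have hcount := Finset.card_mul_le_card_mul (s := K.oddComponents.toFinset) (t := U.toFinset)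
      (fun c u ↦ ∃ a ∈ c.supp, H.Adj u a.1) (m := 3) (n := 3) ?_ ?_
    · rw [← Set.ncard_eq_toFinset_card', ← Set.ncard_eq_toFinset_card'] at hcount
      omega
    · intro c _
      have := (hclosed c).resolve_left (hall c)
      rw [Set.ncard_eq_toFinset_card'] at this
      refine this.trans (Finset.card_le_card fun u hu ↦ ?_)
      simpa [Finset.bipartiteAbove] using hu
    · intro u _
      have hrep : ∀ c : K.ConnectedComponent, ∃ x, (∃ a ∈ c.supp, H.Adj u a.1) →
          x ∈ c.supp ∧ H.Adj u x.1 := by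
        intro c
        by_cases h : ∃ a ∈ c.supp, H.Adj u a.1
        · exact h.imp fun a ha _ ↦ ha
        · exact ⟨c.nonempty_supp.some, fun h' ↦ absurd h' h⟩
      choose f hf using hrep
      have := Finset.card_le_card_of_injOn (t := (Finset.univ : Finset (Fin 3)))
        (s := Finset.bipartiteBelow (fun c u ↦ ∃ a ∈ c.supp, H.Adj u a.1)
          K.oddComponents.toFinset u)
        (fun c ↦ label u (f c)) (by simp) ?_
      · simpa using this
      · intro c hc c' hc' h
        rw [Finset.mem_coe, Finset.mem_bipartiteBelow] at hc hc'
        obtain ⟨h1, h1'⟩ := hf c hc.2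
        obtain ⟨h2, h2'⟩ := hf c' hc'.2
        rw [ConnectedComponent.mem_supp_iff] at h1 h2
        rw [← h1, ← h2]
        rcases hclique u _ _ h1' h2' h with e | e
        · rw [Subtype.ext e]
        · exact ConnectedComponent.sound ((hKadj _ _).2 e).reachable

variable {V : Type*}

/-- The vertices of the gadget graph: the darts of `G` and `g v` extra vertices at each `v`. -/
abbrev GadgetVertex (G : SimpleGraph V) (g : V → ℕ) := G.Dart ⊕ (Σ v, Fin (g v))

namespace GadgetVertex

variable {G : SimpleGraph V} {g : V → ℕ}

/-- The vertex of `G` at which a gadget vertex lies. -/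
def base : GadgetVertex G g → V
  | .inl d => d.fst
  | .inr n => n.1

/-- The adjacency relation of the gadget graph. -/
def Adj : GadgetVertex G g → GadgetVertex G g → Prop
  | .inl d, .inl e => d ≠ e ∧ (d.fst = e.fst ∨ e = d.symm)
  | .inl d, .inr n => d.fst = n.1
  | .inr n, .inl d => d.fst = n.1
  | .inr _, .inr _ => False

/-- The labels of a cover of the neighbourhood of the first argument by three cliques. -/
noncomputable def label : GadgetVertex G g → GadgetVertex G g → Fin 3
  | .inl d, .inl e => if d.fst = e.fst then 0 else 2
  | .inl _, .inr n => Fin.ofNat 3 n.2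
  | .inr _, _ => 0

end GadgetVertex

/-- The graph whose perfect matchings encode the spanning subgraphs of `G` in which the degree of
each vertex `v` is at least `g v` and has the parity of `g v`: the darts matched within their own
gadget are those of the subgraph. -/
def gadgetGraph (G : SimpleGraph V) (g : V → ℕ) : SimpleGraph (GadgetVertex G g) where
  Adj := GadgetVertex.Adj
  symm := ⟨by
    rintro (d | n) (e | m) h
    · refine ⟨h.1.symm, h.2.imp Eq.symm ?_⟩
      rintro rfl
      simp
    all_goals exact h⟩
  loopless := ⟨by
    rintro (d | n) h
    · exact h.1 rfl
    · exact h⟩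

/-- A perfect matching of the gadget graph yields a subgraph with degrees bounded below by `g` and
of the same parity as `g`. -/
lemma exists_subgraph_of_isPerfectMatching_gadgetGraph [Fintype V] (G : SimpleGraph V) (g : V → ℕ)
    (M : (G.gadgetGraph g).Subgraph) (hM : M.IsPerfectMatching) :
    ∃ F : SimpleGraph V, F ≤ G ∧ ∀ v, g v ≤ F.degree v ∧ Even (F.degree v + g v) := by
  rw [Subgraph.isPerfectMatching_iff] at hM
  choose p hp hpu using hM
  have hpp : ∀ a, p (p a) = a := fun a ↦ (hpu _ _ (hp a).symm).symm
  have hpne : ∀ a, p a ≠ a := fun a h ↦ (hp a).adj_sub.ne h.symm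
  obtain ⟨F, hF⟩ : ∃ F : SimpleGraph V, ∀ v w, F.Adj v w ↔
      ∃ h : G.Adj v w, ¬ M.Adj (.inl ⟨(v, w), h⟩) (.inl ⟨(w, v), h.symm⟩) :=
    ⟨{ Adj := fun v w ↦ ∃ h : G.Adj v w, ¬ M.Adj (.inl ⟨(v, w), h⟩) (.inl ⟨(w, v), h.symm⟩)
       symm := ⟨fun v w ⟨h, hn⟩ ↦ ⟨h.symm, fun h' ↦ hn h'.symm⟩⟩
       loopless := ⟨fun v ⟨h, _⟩ ↦ h.ne rfl⟩ }, fun _ _ ↦ Iff.rfl⟩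
  refine ⟨F, fun v w h ↦ ((hF v w).1 h).1, fun v ↦ ?_⟩
  have hbase : ∀ d : G.Dart, (p (.inl d)).base = d.fst ↔ ¬ M.Adj (.inl d) (.inl d.symm) := by
    intro d
    refine ⟨fun h h' ↦ ?_, fun h ↦ ?_⟩
    · rw [← hpu _ _ h'] at h
      exact d.adj.ne h.symm
    · have h1 := hp (.inl d)
      rcases hq : p (.inl d) with e | n
      · rw [hq] at h1
        rcases h1.adj_sub.2 with h2 | rfl
        · exact h2.symm
        · exact absurd h1 h
      · rw [hq] at h1
        exact Eq.symm h1.adj_sub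
  let A : Finset G.Dart := {d | d.fst = v ∧ (p (.inl d)).base = v}
  let B : Finset (Σ v, Fin (g v)) := {n | n.1 = v}
  have hA : F.degree v = A.card := by
    rw [← card_neighborFinset_eq_degree]
    symm
    refine Finset.card_bij (fun d _ ↦ d.snd) ?_ ?_ ?_
    · intro d hd
      obtain ⟨rfl, h⟩ := (Finset.mem_filter.1 hd).2
      rw [mem_neighborFinset, hF]
      exact ⟨d.adj, (hbase d).1 h⟩
    · intro d hd e he h
      exact Dart.ext _ _ (Prod.ext (((Finset.mem_filter.1 hd).2.1).trans
        ((Finset.mem_filter.1 he).2.1).symm) h)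
    · intro w hw
      rw [mem_neighborFinset, hF] at hw
      obtain ⟨h, hn⟩ := hw
      exact ⟨⟨(v, w), h⟩, by
        simp only [A, Finset.mem_filter, Finset.mem_univ, true_and]
        exact (hbase ⟨(v, w), h⟩).2 hn, rfl⟩
  have hB : B.card = g v := by
    have : B = Finset.univ.map (Function.Embedding.sigmaMk (β := fun v ↦ Fin (g v)) v) := by
      ext ⟨w, i⟩
      simp only [B, Finset.mem_filter, Finset.mem_univ, true_and, Finset.mem_map,
        Function.Embedding.sigmaMk_apply]
      constructor
      · rintro rfl
        exact ⟨i, rfl⟩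
      · rintro ⟨j, hj⟩
        exact (congrArg Sigma.fst hj).symm
    rw [this, Finset.card_map, Finset.card_univ, Fintype.card_fin]
  have hdummy : ∀ n : Σ v, Fin (g v), ∃ d : G.Dart, p (.inr n) = .inl d ∧ d.fst = n.1 := by
    intro n
    have h1 := hp (.inr n)
    rcases hq : p (.inr n) with e | m
    · rw [hq] at h1
      exact ⟨e, rfl, h1.adj_sub⟩
    · rw [hq] at h1
      exact h1.adj_sub.elim
  refine ⟨?_, ?_⟩
  · rw [hA, ← hB]
    choose q hq hqf using hdummy
    refine Finset.card_le_card_of_injOn q ?_ ?_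
    · intro n hn
      have hn : n.1 = v := by simpa [B] using hn
      simp only [A, Finset.coe_filter, Finset.mem_univ, true_and, Set.mem_ofPred_eq]
      refine ⟨(hqf n).trans hn, ?_⟩
      rw [← hq, hpp]
      exact hn
    · intro n _ m _ h
      have : p (.inr n) = p (.inr m) := by rw [hq, hq, h]
      simpa [hpp] using congrArg p this
  · have hsum : ∑ _a ∈ A.disjSum B, (1 : ZMod 2) = 0 := by
      have hchar : ∀ a, a ∈ A.disjSum B ↔
          GadgetVertex.base a = v ∧ (p a).base = v := by
        rintro (d | n)
        · rw [Finset.inl_mem_disjSum, Finset.mem_filter]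
          simp only [Finset.mem_univ, true_and]
          exact Iff.rfl
        · obtain ⟨d, hd, hdn⟩ := hdummy n
          simp [B, hd, GadgetVertex.base, hdn]
      refine Finset.sum_involution (fun a _ ↦ p a) (fun _ _ ↦ by decide) (fun a _ _ ↦ hpne a) ?_
        (fun a _ ↦ hpp a)
      intro a ha
      rw [hchar] at ha ⊢
      rw [hpp]
      exact ha.symm
    rw [Finset.sum_const, nsmul_one, Finset.card_disjSum, hB, ← hA] at hsum
    exact (ZMod.natCast_eq_zero_iff_even).1 hsum

end SimpleGraph

/-- Every edge cut of a 3-edge-connected graph has at least three edges. -/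
lemma ThreeEdgeConnected.three_le_card_boundary {V : Type*} [Fintype V] {G : SimpleGraph V}
    (h3 : ThreeEdgeConnected G) (S : Set V) {v w : V} (hv : v ∈ S) (hw : w ∉ S) :
    3 ≤ {d : G.Dart | d.fst ∈ S ∧ d.snd ∉ S}.ncard := by
  by_contra! hlt
  have hcon := h3 (SimpleGraph.Dart.edge '' {d : G.Dart | d.fst ∈ S ∧ d.snd ∉ S})
    ((Set.ncard_image_le (Set.toFinite _)).trans (by omega))
  obtain ⟨q⟩ := hcon.preconnected v w
  obtain ⟨d, -, hd1, hd2⟩ := q.exists_boundary_dart S hv hw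
  have hd := d.adj
  rw [SimpleGraph.deleteEdges_adj] at hd
  exact hd.2 ⟨⟨d.toProd, hd.1⟩, ⟨hd1, hd2⟩, rfl⟩

/-- In a 3-edge-connected graph of minimum degree at least three, every parity function with values
at most two is realized by a subgraph with degrees bounded below by the function. -/
lemma ThreeEdgeConnected.exists_subgraph {V : Type*} [Fintype V] {G : SimpleGraph V}
    (h3 : ThreeEdgeConnected G) (hdeg : ∀ v : V, 3 ≤ G.degree v) (g : V → ℕ) (hg : ∀ v, g v ≤ 2)
    (heven : Even (∑ v, g v)) :
    ∃ F : SimpleGraph V, F ≤ G ∧ ∀ v, g v ≤ F.degree v ∧ Even (F.degree v + g v) := by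
  suffices h : ∃ M : (G.gadgetGraph g).Subgraph, M.IsPerfectMatching by
    obtain ⟨M, hM⟩ := h
    exact G.exists_subgraph_of_isPerfectMatching_gadgetGraph g M hM
  refine SimpleGraph.exists_isPerfectMatching_of_three_le_ncard _ ?_
    SimpleGraph.GadgetVertex.label ?_ ?_
  · rw [Nat.card_eq_fintype_card, Fintype.card_sum, G.dart_card_eq_twice_card_edges,
      Fintype.card_sigma]
    simpa using (even_two_mul _).add heven
  · rintro (d | n) (a | a) (b | b) ha hb hab
    · change d ≠ a ∧ _ at ha
      change d ≠ b ∧ _ at hb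
      by_cases hd : d.fst = a.fst
      · have hd' : d.fst = b.fst := by
          by_contra hne
          simp [SimpleGraph.GadgetVertex.label, hd] at hab
          simp [← hd, hne] at hab
        by_cases h : a = b
        · exact .inl (congrArg _ h)
        · exact .inr ⟨h, .inl (hd.symm.trans hd')⟩
      · have hd' : d.fst ≠ b.fst := by
          intro he
          simp [SimpleGraph.GadgetVertex.label, hd, ← he] at hab
        rw [ha.2.resolve_left hd, hb.2.resolve_left hd']
        exact .inl rfl
    · right
      have hb : d.fst = b.1 := hb
      have h2 := (hg b.1)
      have h3 := b.2.2
      have : d.fst = a.fst := by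
        by_contra hne
        simp only [SimpleGraph.GadgetVertex.label, hne, if_false] at hab
        have := congrArg Fin.val hab
        simp only [Fin.ofNat] at this
        change 2 = _ at this
        omega
      exact this.symm.trans hb
    · right
      have ha : d.fst = a.1 := ha
      have h2 := (hg a.1)
      have h3 := a.2.2
      have : d.fst = b.fst := by
        by_contra hne
        simp only [SimpleGraph.GadgetVertex.label, hne, if_false] at hab
        have := congrArg Fin.val hab
        simp only [Fin.ofNat] at this
        change _ = 2 at this
        omega
      exact this.symm.trans ha
    · left
      obtain ⟨v, i⟩ := a
      obtain ⟨w, j⟩ := b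
      obtain rfl : d.fst = v := ha
      obtain rfl : d.fst = w := hb
      have hv := hg d.fst
      have := congrArg Fin.val hab
      simp only [SimpleGraph.GadgetVertex.label, Fin.ofNat] at this
      have : i = j := Fin.ext (by omega)
      rw [this]
    · by_cases h : a = b
      · exact .inl (congrArg _ h)
      · exact .inr ⟨h, .inl (Eq.trans ha (Eq.symm hb))⟩
    all_goals first | exact ha.elim | exact hb.elim
  · intro U S hS hdisj hcl
    have hSU : ∀ a ∈ S, a ∉ U := fun a ha ↦ Set.disjoint_left.1 hdisj ha
    by_cases hdart : ∃ d : G.Dart, .inl d ∈ S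
    · obtain ⟨d₀, hd₀⟩ := hdart
      let C : Set V := {v | ∃ d : G.Dart, .inl d ∈ S ∧ d.fst = v}
      have hclq : ∀ b : G.Dart, b.fst ∈ C → .inl b ∉ U → .inl b ∈ S := by
        rintro b ⟨d, hd, hdb⟩ hb
        by_cases h : d = b
        · exact h ▸ hd
        · exact hcl _ hd _ hb ⟨h, .inl hdb⟩
      by_cases hC : ∃ w, w ∉ C
      · obtain ⟨w, hw⟩ := hC
        right
        refine (h3.three_le_card_boundary C ⟨d₀, hd₀, rfl⟩ hw).trans ?_
        have hout : ∀ b : G.Dart, b.snd ∉ C → .inl b ∉ U → b.fst ∈ C → .inl b.symm ∈ U := by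
          intro b hb hbU hbC
          by_contra hn
          exact hb ⟨b.symm, hcl _ (hclq b hbC hbU) _ hn
            ⟨fun h ↦ b.adj.ne (congrArg (fun e : G.Dart ↦ e.fst) h), .inr rfl⟩, rfl⟩
        refine Set.ncard_le_ncard_of_injOn
          (fun b ↦ if (.inl b : G.GadgetVertex g) ∈ U then .inl b else .inl b.symm) ?_ ?_
          (Set.toFinite _)
        · rintro b ⟨hb1, hb2⟩
          by_cases hbU : (.inl b : G.GadgetVertex g) ∈ U
          · simp only [hbU, if_true]
            obtain ⟨d, hd, hdb⟩ := hb1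
            refine ⟨hbU, _, hd, ?_, .inl hdb.symm⟩
            rintro rfl
            exact hSU _ hd hbU
          · simp only [hbU, if_false]
            refine ⟨hout b hb2 hbU hb1, _, hclq b hb1 hbU, ?_, .inr (by simp)⟩
            exact fun h ↦ b.adj.ne (congrArg (fun e : G.Dart ↦ e.snd) h)
        · rintro b ⟨hb1, hb2⟩ e ⟨he1, he2⟩ h
          dsimp only at h
          split_ifs at h
          · exact Sum.inl_injective h
          · rw [Sum.inl_injective h] at hb1
            exact absurd hb1 he2
          · rw [← Sum.inl_injective h] at he1
            exact absurd he1 hb2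
          · exact SimpleGraph.Dart.symm_involutive.injective (Sum.inl_injective h)
      · push Not at hC
        left
        refine Set.Subset.antisymm hSU ?_
        rintro (b | n) hb
        · exact hclq b (hC _) hb
        · obtain ⟨d, hd, hdn⟩ := hC n.1
          exact hcl _ hd _ hb hdn
    · push Not at hdart
      right
      obtain ⟨d | n, hn⟩ := hS
      · exact absurd hn (hdart d)
      have hdarts : ∀ d : G.Dart, d.fst = n.1 → .inl d ∈ U := by
        intro d hd
        by_contra hdU
        exact hdart d (hcl _ hn _ hdU hd)
      refine (hdeg n.1).trans ?_
      rw [← G.dart_fst_fiber_card_eq_degree n.1, ← Set.ncard_coe_finset]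
      refine Set.ncard_le_ncard_of_injOn .inl ?_ Sum.inl_injective.injOn (Set.toFinite _)
      intro d hd
      have hd : d.fst = n.1 := by simpa using hd
      exact ⟨hdarts d hd, _, hn, hd⟩

theorem three_edge_connected_strong_parity {V : Type*} [Fintype V] (G : SimpleGraph V)
    (h3 : ThreeEdgeConnected G) (hdeg : ∀ v : V, 3 ≤ G.degree v) :
    StrongParityProperty G := by
  intro X hX
  obtain ⟨F, hF, hFg⟩ := h3.exists_subgraph hdeg (fun v ↦ if v ∈ X then 1 else 2)
    (fun v ↦ by split_ifs <;> omega) (by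
      rw [Finset.sum_ite]
      simpa using hX.add (even_two.mul_left _))
  refine ⟨F, hF, fun v ↦ ?_, fun v hv ↦ ?_, fun v hv ↦ ?_⟩
  · have := (hFg v).1
    split_ifs at this <;> omega
  · have := (hFg v).2
    rw [if_pos hv] at this
    grind
  · have := (hFg v).2
    rw [if_neg hv] at this
    grind
end

section
/- It is not true that every 2-edge-connected graph with minimum degree at least three has the strong parity property; i.e., there exists a 2-edge-connected graph G with δ(G) ≥ 3 that fails the strong parity property. -/
open scoped Classical

/-- `G` is 2-edge-connected: deleting any single edge leaves it connected. -/
def TwoEdgeConnected {V : Type*} (G : SimpleGraph V) : Prop :=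
  ∀ e : Sym2 V, (G.deleteEdges {e}).Connected

namespace SimpleGraph

/-- A graph is connected if iterating some function that moves every vertex other than the root
along an edge takes every vertex to the root. -/
theorem connected_of_iterate_eq {V : Type*} {G : SimpleGraph V} (root : V) (parent : V → V) (n : ℕ)
    (hadj : ∀ v, v = root ∨ G.Adj v (parent v)) (hroot : parent root = root)
    (hiter : ∀ v, parent^[n] v = root) : G.Connected := by
  have step : ∀ v, G.Reachable v (parent v) := fun v => by
    rcases hadj v with rfl | h
    · rw [hroot]
    · exact h.reachable
  have steps : ∀ m v, G.Reachable v (parent^[m] v) := by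
    intro m
    induction m with
    | zero => exact fun v => Reachable.refl v
    | succ m ih => exact fun v => (step v).trans (ih (parent v))
  have toRoot : ∀ v, G.Reachable v root := fun v => hiter v ▸ steps n v
  exact (connected_iff _).2 ⟨fun v w => (toRoot v).trans (toRoot w).symm, ⟨root⟩⟩

theorem degree_eq_sum_of_adj_mem {V : Type*} [Fintype V] {F : SimpleGraph V} {v : V}
    {s : Finset V} (h : ∀ w, F.Adj v w → w ∈ s) :
    F.degree v = ∑ w ∈ s, if F.Adj v w then 1 else 0 := by
  rw [← Finset.card_filter, ← card_neighborFinset_eq_degree]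
  congr 1
  ext w
  simpa using h w

end SimpleGraph

namespace SubdividedK4

/-- The other end of the edge of colour `k` at `i`, in the proper 3-edge-colouring of `K₄`. -/
def mate (i : Fin 4) (k : Fin 3) : Fin 4 := i ^^^ k.succ

/-- Four hubs, and for each end of each edge of `K₄` a port and an inner vertex. -/
abbrev Vertex : Type := Fin 4 ⊕ (Fin 4 × Fin 3) ⊕ (Fin 4 × Fin 3)

abbrev hub (i : Fin 4) : Vertex := Sum.inl i

abbrev port (i : Fin 4) (k : Fin 3) : Vertex := Sum.inr (Sum.inl (i, k))

abbrev inner (i : Fin 4) (k : Fin 3) : Vertex := Sum.inr (Sum.inr (i, k))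

def neighbors : Vertex → Finset Vertex
  | .inl i => {port i 0, port i 1, port i 2}
  | .inr (.inl (i, k)) => {hub i, inner i k, inner (mate i k) k}
  | .inr (.inr (i, k)) => {port i k, port (mate i k) k, inner (mate i k) k}

/-- The cubic graph obtained from `K₄` by replacing every edge with a copy of `K₄` minus an edge,
whose two vertices of degree two (the ports) are joined to the ends of the replaced edge. -/
def graph : SimpleGraph Vertex where
  Adj v w := w ∈ neighbors v
  symm := ⟨fun v w h => by revert v w; decide⟩
  loopless := ⟨by decide⟩

theorem mate_mate : ∀ i k, mate (mate i k) k = i := by decide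

theorem mate_ne : ∀ i k, mate i k ≠ i := by decide

theorem card_neighbors : ∀ v, (neighbors v).card = 3 := by decide

/-- The parent function of a spanning tree of `graph` that is rooted at `hub r` and passes through
the gadgets of the three edges of `K₄` at `r`. -/
def parent (r : Fin 4) : Vertex → Vertex
  | .inl i =>
    if i = r then hub i
    else if mate i 0 = r then port i 0
    else if mate i 1 = r then port i 1
    else port i 2
  | .inr (.inl (i, k)) =>
    if i = r ∨ mate i (k + 1) = r then hub i
    else if mate i k = r then inner i k
    else inner (mate i k) k
  | .inr (.inr (i, k)) =>
    if i = r ∨ mate i (k + 1) = r then port i k else port (mate i k) k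

theorem parent_mem_neighbors : ∀ r v, v = hub r ∨ parent r v ∈ neighbors v := by decide

theorem parent_hub : ∀ r, parent r (hub r) = hub r := by decide

theorem iterate_parent : ∀ r v, (parent r)^[8] v = hub r := by decide

set_option maxRecDepth 10000 in
theorem exists_tree_avoiding_edge_of_tree : ∀ u, ∃ r, ∀ v,
    v = hub r ∨ s(v, parent r v) ≠ s(u, parent 0 u) := by decide

theorem exists_tree_avoiding (e : Sym2 Vertex) : ∃ r, ∀ v, v = hub r ∨ s(v, parent r v) ≠ e := by
  by_cases h : ∃ u, s(u, parent 0 u) = e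
  · obtain ⟨u, rfl⟩ := h
    exact exists_tree_avoiding_edge_of_tree u
  · exact ⟨0, fun v => Or.inr fun hv => h ⟨v, hv⟩⟩

theorem twoEdgeConnected_graph : TwoEdgeConnected graph := by
  intro e
  obtain ⟨r, hr⟩ := exists_tree_avoiding e
  refine SimpleGraph.connected_of_iterate_eq (hub r) (parent r) 8 (fun v => ?_) (parent_hub r)
    (iterate_parent r)
  rcases hr v with h | h
  · exact Or.inl h
  · refine (parent_mem_neighbors r v).imp_right fun hv => ?_
    rw [SimpleGraph.deleteEdges_adj]
    exact ⟨hv, h⟩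

theorem degree_graph (v : Vertex) : graph.degree v = 3 := by
  rw [← SimpleGraph.card_neighborFinset_eq_degree]
  refine (congrArg Finset.card ?_).trans (card_neighbors v)
  ext w
  rw [SimpleGraph.mem_neighborFinset]
  rfl

/-- One inner vertex of each gadget. -/
def oddSet : Finset Vertex :=
  (Finset.univ.filter fun p : Fin 4 × Fin 3 => p.1 < mate p.1 p.2).image fun p => inner p.1 p.2

theorem card_oddSet : oddSet.card = 6 := by decide

theorem hub_notMem_oddSet (i : Fin 4) : hub i ∉ oddSet := by simp [oddSet]

theorem port_notMem_oddSet (i : Fin 4) (k : Fin 3) : port i k ∉ oddSet := by simp [oddSet]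

theorem inner_mem_oddSet {i : Fin 4} {k : Fin 3} : inner i k ∈ oddSet ↔ i < mate i k := by
  simp [oddSet]

section Subgraph

variable {F : SimpleGraph Vertex}

theorem degree_hub (hF : F ≤ graph) (i : Fin 4) :
    F.degree (hub i) = (if F.Adj (hub i) (port i 0) then 1 else 0) +
      (if F.Adj (hub i) (port i 1) then 1 else 0) +
      (if F.Adj (hub i) (port i 2) then 1 else 0) := by
  rw [SimpleGraph.degree_eq_sum_of_adj_mem
    fun w hw => (hF hw : w ∈ neighbors (hub i)), neighbors]
  simp [-Finset.sum_boole, add_assoc]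

theorem degree_port (hF : F ≤ graph) (i : Fin 4) (k : Fin 3) :
    F.degree (port i k) = (if F.Adj (hub i) (port i k) then 1 else 0) +
      (if F.Adj (port i k) (inner i k) then 1 else 0) +
      (if F.Adj (port i k) (inner (mate i k) k) then 1 else 0) := by
  rw [SimpleGraph.degree_eq_sum_of_adj_mem
    fun w hw => (hF hw : w ∈ neighbors (port i k)), neighbors]
  simp [-Finset.sum_boole, add_assoc, F.adj_comm (hub i), (mate_ne i k).symm]

theorem degree_inner (hF : F ≤ graph) (i : Fin 4) (k : Fin 3) :
    F.degree (inner i k) = (if F.Adj (port i k) (inner i k) then 1 else 0) +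
      (if F.Adj (port (mate i k) k) (inner i k) then 1 else 0) +
      (if F.Adj (inner i k) (inner (mate i k) k) then 1 else 0) := by
  rw [SimpleGraph.degree_eq_sum_of_adj_mem
    fun w hw => (hF hw : w ∈ neighbors (inner i k)), neighbors]
  simp [-Finset.sum_boole, add_assoc, F.adj_comm (port _ _), (mate_ne i k).symm]

theorem gadget_uses_one_hub_edge (hF : F ≤ graph) (hodd : ∀ v ∈ oddSet, Odd (F.degree v))
    (heven : ∀ v ∉ oddSet, Even (F.degree v)) {i j : Fin 4} {k : Fin 3} (hj : mate i k = j)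
    (hij : i < j) :
    (if F.Adj (hub i) (port i k) then 1 else 0) +
      (if F.Adj (hub j) (port j k) then 1 else 0) = 1 := by
  have hi : mate j k = i := hj ▸ mate_mate i k
  have h₁ := heven _ (port_notMem_oddSet i k)
  have h₂ := heven _ (port_notMem_oddSet j k)
  have h₃ := hodd _ (inner_mem_oddSet.2 (hj ▸ hij))
  have h₄ := heven (inner j k) (by rw [inner_mem_oddSet, hi]; exact hij.not_gt)
  rw [degree_port hF, hj, Nat.even_iff] at h₁
  rw [degree_port hF, hi, Nat.even_iff] at h₂
  rw [degree_inner hF, hj, Nat.odd_iff] at h₃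
  rw [degree_inner hF, hi, Nat.even_iff, F.adj_comm (inner j k)] at h₄
  split_ifs at * <;> omega

theorem two_le_hub_edges (hF : F ≤ graph) (hpos : ∀ v, 1 ≤ F.degree v)
    (heven : ∀ v ∉ oddSet, Even (F.degree v)) (i : Fin 4) :
    2 ≤ (if F.Adj (hub i) (port i 0) then 1 else 0) +
      (if F.Adj (hub i) (port i 1) then 1 else 0) +
      (if F.Adj (hub i) (port i 2) then 1 else 0) := by
  rw [← degree_hub hF]
  obtain ⟨m, hm⟩ := heven _ (hub_notMem_oddSet i)
  have := hpos (hub i)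
  omega

end Subgraph

theorem not_strongParityProperty_graph : ¬ StrongParityProperty graph := by
  intro h
  obtain ⟨F, hF, hpos, hodd, heven⟩ := h oddSet (by rw [card_oddSet]; decide)
  have one := fun (i j : Fin 4) (k : Fin 3) =>
    gadget_uses_one_hub_edge (i := i) (j := j) (k := k) hF hodd heven
  have two := two_le_hub_edges hF hpos heven
  have h01 := one 0 1 0 (by decide) (by decide)
  have h23 := one 2 3 0 (by decide) (by decide)
  have h02 := one 0 2 1 (by decide) (by decide)
  have h13 := one 1 3 1 (by decide) (by decide)
  have h03 := one 0 3 2 (by decide) (by decide)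
  have h12 := one 1 2 2 (by decide) (by decide)
  linarith [two 0, two 1, two 2, two 3]

end SubdividedK4

theorem conjecture_false :
    ∃ (V : Type) (_ : Fintype V) (G : SimpleGraph V),
      TwoEdgeConnected G ∧ (∀ v : V, 3 ≤ G.degree v) ∧ ¬ StrongParityProperty G :=
  ⟨SubdividedK4.Vertex, inferInstance, SubdividedK4.graph, SubdividedK4.twoEdgeConnected_graph,
    fun v => (SubdividedK4.degree_graph v).ge, SubdividedK4.not_strongParityProperty_graph⟩
end

section
/- Every 3-regular 3-edge-connected graph has the strong parity property. -/
open scoped Classical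

/-- The indicator of a proposition. -/
noncomputable def ind (p : Prop) : ℕ := if p then 1 else 0

theorem sum_ind {ι : Type*} (s : Finset ι) (p : ι → Prop) [DecidablePred p] :
    ∑ i ∈ s, ind (p i) = (s.filter p).card := by
  rw [Finset.card_filter]
  refine Finset.sum_congr rfl fun i _ => ?_
  unfold ind
  congr

theorem sum_ind_eq {ι : Type*} (s : Finset ι) (x : ι) : ∑ i ∈ s, ind (x = i) = ind (x ∈ s) := by
  simp [ind]

open SimpleGraph in
/-- Weighted arcs loading each vertex by at most `N`, but every odd vertex set's boundary by at
least `N`, force a perfect matching. -/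
theorem exists_isPerfectMatching_of_arcs {W I : Type*} [Fintype W] [Fintype I]
    (H : SimpleGraph W) (s t : I → W) (m : I → ℕ) (N : ℕ) (hN : 0 < N)
    (hadj : ∀ i, m i ≠ 0 → H.Adj (s i) (t i))
    (hdeg : ∀ a, ∑ i, m i * (ind (s i = a) + ind (t i = a)) ≤ N)
    (hcut : ∀ C : Finset W, Odd C.card → N ≤ ∑ i, m i * ind ¬(s i ∈ C ↔ t i ∈ C)) :
    ∃ M : H.Subgraph, M.IsPerfectMatching := by
  rw [tutte]
  intro S hS
  rw [IsTutteViolator] at hS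
  set K := ((⊤ : H.Subgraph).deleteVerts S).coe with hK
  let B : K.ConnectedComponent → Finset W := fun c => (Subtype.val '' c.supp).toFinset
  have hB : ∀ c w, w ∈ B c ↔ ∃ h : w ∈ ((⊤ : H.Subgraph).deleteVerts S).verts,
      K.connectedComponentMk ⟨w, h⟩ = c := by
    intro c w
    simp [B]
  have hmem : ∀ w, w ∈ ((⊤ : H.Subgraph).deleteVerts S).verts ↔ w ∉ S := by
    intro w; simp
  have hnbr : ∀ c a b, H.Adj a b → a ∈ B c → b ∉ S → b ∈ B c := by
    intro c a b hab ha hb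
    obtain ⟨h, h'⟩ := (hB _ _).1 ha
    refine (hB _ _).2 ⟨(hmem b).2 hb, ?_⟩
    rw [← h']
    refine ConnectedComponent.sound (Adj.reachable ?_)
    simp only [hK, Subgraph.coe_adj, Subgraph.deleteVerts_adj]
    have ha' := (hmem a).1 h
    simp [ha', hb, hab.symm]
  have hBS : ∀ c a, a ∈ B c → a ∉ S := fun c a h => (hmem a).1 ((hB _ _).1 h).1
  have hodd : ∀ c ∈ K.oddComponents, Odd (B c).card := by
    intro c hc
    have h1 : Odd c.supp.ncard := hc
    rwa [← Set.ncard_image_of_injective _ Subtype.val_injective, Set.ncard_eq_toFinset_card'] at h1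
  have key : ∀ i, (∑ c ∈ K.oddComponents.toFinset, m i * ind ¬(s i ∈ B c ↔ t i ∈ B c))
      ≤ ∑ a ∈ S.toFinset, m i * (ind (s i = a) + ind (t i = a)) := by
    intro i
    rw [← Finset.mul_sum, ← Finset.mul_sum, Finset.sum_add_distrib, sum_ind_eq, sum_ind_eq]
    by_cases hm : m i = 0
    · simp [hm]
    refine Nat.mul_le_mul_left _ ?_
    have ha := hadj i hm
    have one : ∀ c₀, (∀ c, ¬ (s i ∈ B c ↔ t i ∈ B c) → c = c₀) →
        (∑ c ∈ K.oddComponents.toFinset, ind ¬(s i ∈ B c ↔ t i ∈ B c)) ≤ 1 := by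
      intro c₀ h
      rw [sum_ind, Finset.card_le_one_iff]
      intro c c' hc hc'
      rw [h c (Finset.mem_filter.1 hc).2, h c' (Finset.mem_filter.1 hc').2]
    by_cases hs : s i ∈ S <;> by_cases ht : t i ∈ S
    · rw [Finset.sum_eq_zero]
      · simp
      · intro c _
        refine if_neg (not_not.2 ?_)
        exact ⟨fun h => absurd hs (hBS _ _ h), fun h => absurd ht (hBS _ _ h)⟩
    · refine (one (K.connectedComponentMk ⟨t i, (hmem _).2 ht⟩) ?_).trans (by simp [ind, hs, ht])
      intro c hc
      have : t i ∈ B c := by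
        by_contra h
        exact hc ⟨fun h => absurd hs (hBS _ _ h), fun h' => absurd h' h⟩
      exact ((hB _ _).1 this).2.symm
    · refine (one (K.connectedComponentMk ⟨s i, (hmem _).2 hs⟩) ?_).trans (by simp [ind, hs, ht])
      intro c hc
      have : s i ∈ B c := by
        by_contra h
        exact hc ⟨fun h' => absurd h' h, fun h => absurd ht (hBS _ _ h)⟩
      exact ((hB _ _).1 this).2.symm
    · rw [Finset.sum_eq_zero]
      · simp
      · intro c _
        refine if_neg (not_not.2 ?_)
        exact ⟨fun h => hnbr c _ _ ha h ht, fun h => hnbr c _ _ ha.symm h hs⟩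
  have total : K.oddComponents.toFinset.card * N ≤ S.toFinset.card * N := by
    calc _ ≤ ∑ c ∈ K.oddComponents.toFinset, ∑ i, m i * ind ¬(s i ∈ B c ↔ t i ∈ B c) := by
          rw [← smul_eq_mul]
          exact Finset.card_nsmul_le_sum _ _ _ fun c hc =>
            hcut _ (hodd c (Set.mem_toFinset.1 hc))
      _ = ∑ i, ∑ c ∈ K.oddComponents.toFinset, m i * ind ¬(s i ∈ B c ↔ t i ∈ B c) :=
          Finset.sum_comm
      _ ≤ ∑ i, ∑ a ∈ S.toFinset,
            m i * (ind (s i = a) + ind (t i = a)) :=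
          Finset.sum_le_sum fun i _ => key i
      _ = ∑ a ∈ S.toFinset, ∑ i,
            m i * (ind (s i = a) + ind (t i = a)) := Finset.sum_comm
      _ ≤ _ := by
          rw [← smul_eq_mul]
          exact Finset.sum_le_card_nsmul _ _ _ fun a _ => hdeg a
  rw [Set.ncard_eq_toFinset_card', Set.ncard_eq_toFinset_card'] at hS
  exact absurd (Nat.le_of_mul_le_mul_right total hN) (not_le.2 hS)

open SimpleGraph in
/-- A proper nonempty vertex set is left by at least three darts. -/
theorem ThreeEdgeConnected.three_le_card_boundary_s12 {V : Type*} [Fintype V] {G : SimpleGraph V}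
    (h3 : ThreeEdgeConnected G) (U : V → Prop) {x y : V} (hx : U x) (hy : ¬ U y) :
    3 ≤ (Finset.univ.filter fun d : G.Dart => U d.fst ∧ ¬ U d.snd).card := by
  by_contra! h
  set A := Finset.univ.filter fun d : G.Dart => U d.fst ∧ ¬ U d.snd with hA
  have hs : ((A.image Dart.edge : Finset (Sym2 V)) : Set (Sym2 V)).ncard ≤ 2 := by
    rw [Set.ncard_coe_finset]
    exact Finset.card_image_le.trans (by omega)
  obtain ⟨p⟩ := (h3 _ hs).preconnected x y
  obtain ⟨d, -, hd, hd'⟩ := p.exists_boundary_dart {v | U v} hx hy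
  have hadj := d.adj
  rw [deleteEdges_adj] at hadj
  refine hadj.2 ?_
  rw [Finset.mem_coe, Finset.mem_image]
  exact ⟨⟨(d.fst, d.snd), hadj.1⟩, by simpa [hA] using ⟨hd, hd'⟩, rfl⟩

namespace ParityGadget

open SimpleGraph

variable {V : Type*} (G : SimpleGraph V) (X : Finset V)

/-- The ports at the vertices of `X`: one for each dart leaving `X`. -/
abbrev Port := {d : G.Dart // d.fst ∈ X}

/-- The vertices of the gadget graph: the original vertices (centers) and the ports. -/
abbrev Vertex := V ⊕ Port G X

/-- The arcs of the gadget graph: one for each dart, one from a center to each of its ports, and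
the pairs of ports. -/
abbrev Arc := G.Dart ⊕ (Port G X ⊕ Port G X × Port G X)

variable {G}

/-- The gadget vertex at which a dart starts. -/
noncomputable def start (d : G.Dart) : Vertex G X :=
  if h : d.fst ∈ X then Sum.inr ⟨d, h⟩ else Sum.inl d.fst

variable {X}

/-- The source of an arc. -/
noncomputable def src : Arc G X → Vertex G X
  | Sum.inl d => start X d
  | Sum.inr (Sum.inl p) => Sum.inl p.1.fst
  | Sum.inr (Sum.inr pq) => Sum.inr pq.1

/-- The target of an arc. -/
noncomputable def tgt : Arc G X → Vertex G X
  | Sum.inl d => start X d.symm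
  | Sum.inr (Sum.inl p) => Sum.inr p
  | Sum.inr (Sum.inr pq) => Sum.inr pq.2

/-- The weight of an arc; pairs of ports count only if they are distinct ports of one vertex. -/
noncomputable def weight : Arc G X → ℕ
  | Sum.inl _ => 2
  | Sum.inr (Sum.inl _) => 4
  | Sum.inr (Sum.inr pq) => ind (pq.1 ≠ pq.2 ∧ pq.1.1.fst = pq.2.1.fst)

variable (G X) in
/-- The graph obtained from `G` by replacing each vertex of `X` by a `K₄` on a center and
three ports, the ports taking over the edges of the vertex. -/
def gadget : SimpleGraph (Vertex G X) :=
  SimpleGraph.fromRel fun a b => ∃ i : Arc G X, weight i ≠ 0 ∧ src i = a ∧ tgt i = b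

theorem start_of_mem {d : G.Dart} (h : d.fst ∈ X) : start X d = Sum.inr ⟨d, h⟩ := dif_pos h

theorem start_of_notMem {d : G.Dart} (h : d.fst ∉ X) : start X d = Sum.inl d.fst := dif_neg h

theorem start_eq_inl {d : G.Dart} {v : V} : start X d = Sum.inl v ↔ d.fst = v ∧ v ∉ X := by
  unfold start
  split_ifs with h
  · simp only [false_iff]
    rintro ⟨rfl, h'⟩
    exact h' h
  · simp only [Sum.inl.injEq]
    constructor
    · rintro rfl
      exact ⟨rfl, h⟩
    · exact And.left

theorem start_eq_inr {d : G.Dart} {p : Port G X} : start X d = Sum.inr p ↔ d = p.1 := by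
  unfold start
  split_ifs with h
  · simp [Subtype.ext_iff]
  · simp only [false_iff]
    rintro rfl
    exact h p.2

theorem fst_eq_of_start_eq {d e : G.Dart} (h : start X d = start X e) : d.fst = e.fst := by
  by_cases he : e.fst ∈ X
  · rw [start_of_mem he, start_eq_inr] at h
    rw [h]
  · rw [start_of_notMem he, start_eq_inl] at h
    exact h.1

theorem start_ne_start_symm (d : G.Dart) : start X d ≠ start X d.symm :=
  fun h => d.adj.ne (fst_eq_of_start_eq h)

theorem gadget_adj_of_weight_ne_zero {i : Arc G X} (hi : weight i ≠ 0) :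
    (gadget G X).Adj (src i) (tgt i) := by
  refine (fromRel_adj _ _ _).2 ⟨?_, Or.inl ⟨i, hi, rfl, rfl⟩⟩
  match i, hi with
  | Sum.inl d, _ => exact start_ne_start_symm d
  | Sum.inr (Sum.inl p), _ => simp [src, tgt]
  | Sum.inr (Sum.inr pq), hi =>
    simp only [weight, ind, ne_eq, ite_eq_right_iff, one_ne_zero, imp_false, not_not] at hi
    simpa [src, tgt] using hi.1

theorem gadget_adj_cases {a b : Vertex G X} (h : (gadget G X).Adj a b) :
    (∃ d : G.Dart, a = start X d ∧ b = start X d.symm) ∨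
    (∃ p : Port G X, a = Sum.inl p.1.fst ∧ b = Sum.inr p ∨ a = Sum.inr p ∧ b = Sum.inl p.1.fst) ∨
    ∃ p q : Port G X, p ≠ q ∧ p.1.fst = q.1.fst ∧ a = Sum.inr p ∧ b = Sum.inr q := by
  obtain ⟨-, ⟨i, hi, rfl, rfl⟩ | ⟨i, hi, rfl, rfl⟩⟩ := (fromRel_adj _ _ _).1 h <;>
  match i, hi with
  | Sum.inl d, _ => first
    | exact Or.inl ⟨d, rfl, rfl⟩
    | exact Or.inl ⟨d.symm, rfl, by rw [Dart.symm_symm]; rfl⟩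
  | Sum.inr (Sum.inl p), _ => first
    | exact Or.inr (Or.inl ⟨p, Or.inl ⟨rfl, rfl⟩⟩)
    | exact Or.inr (Or.inl ⟨p, Or.inr ⟨rfl, rfl⟩⟩)
  | Sum.inr (Sum.inr pq), hi =>
    simp only [weight, ind, ne_eq, ite_eq_right_iff, one_ne_zero, imp_false, not_not] at hi
    first
    | exact Or.inr (Or.inr ⟨pq.1, pq.2, hi.1, hi.2, rfl, rfl⟩)
    | exact Or.inr (Or.inr ⟨pq.2, pq.1, Ne.symm hi.1, hi.2.symm, rfl, rfl⟩)

theorem gadget_adj_center_of_notMem {v : V} (hv : v ∉ X) {b : Vertex G X}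
    (h : (gadget G X).Adj (Sum.inl v) b) : ∃ d : G.Dart, d.fst = v ∧ b = start X d.symm := by
  obtain ⟨d, hd, hb⟩ | ⟨p, ⟨hp, -⟩ | ⟨hp, -⟩⟩ | ⟨p, q, -, -, hp, -⟩ := gadget_adj_cases h
  · exact ⟨d, (start_eq_inl.1 hd.symm).1, hb⟩
  · exact absurd p.2 (Sum.inl_injective hp ▸ hv)
  · cases hp
  · cases hp

theorem gadget_adj_center_of_mem {v : V} (hv : v ∈ X) {b : Vertex G X}
    (h : (gadget G X).Adj (Sum.inl v) b) : ∃ p : Port G X, p.1.fst = v ∧ b = Sum.inr p := by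
  obtain ⟨d, hd, hb⟩ | ⟨p, ⟨hp, hb⟩ | ⟨hp, -⟩⟩ | ⟨p, q, -, -, hp, -⟩ := gadget_adj_cases h
  · exact absurd hv (start_eq_inl.1 hd.symm).2
  · exact ⟨p, (Sum.inl_injective hp).symm, hb⟩
  · cases hp
  · cases hp

theorem gadget_adj_port {p : Port G X} {b : Vertex G X} (h : (gadget G X).Adj (Sum.inr p) b) :
    b = Sum.inl p.1.fst ∨ b = start X p.1.symm ∨
      ∃ q : Port G X, p ≠ q ∧ p.1.fst = q.1.fst ∧ b = Sum.inr q := by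
  obtain ⟨d, hd, hb⟩ | ⟨p', ⟨hp, hb⟩ | ⟨hp, hb⟩⟩ | ⟨p', q, hne, hf, hp, hb⟩ := gadget_adj_cases h
  · rw [start_eq_inr.1 hd.symm] at hb
    exact Or.inr (Or.inl hb)
  · cases hp
  · cases hp
    exact Or.inl hb
  · cases hp
    exact Or.inr (Or.inr ⟨q, hne, hf, hb⟩)

variable [Fintype V]

theorem card_darts_at (hreg : G.IsRegularOfDegree 3) (v : V) :
    (Finset.univ.filter fun d : G.Dart => d.fst = v).card = 3 := by
  have h := G.dart_fst_fiber_card_eq_degree v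
  rw [hreg.degree_eq v] at h
  convert h

theorem card_ports_at (hreg : G.IsRegularOfDegree 3) {v : V} (hv : v ∈ X) :
    (Finset.univ.filter fun p : Port G X => p.1.fst = v).card = 3 := by
  rw [← card_darts_at hreg v, ← Finset.card_map (Function.Embedding.subtype _)]
  congr 1
  ext d
  simp only [Finset.mem_map, Finset.mem_filter, Finset.mem_univ, true_and,
    Function.Embedding.subtype_apply]
  constructor
  · rintro ⟨p, hp, rfl⟩
    exact hp
  · rintro rfl
    exact ⟨⟨d, hv⟩, rfl, rfl⟩

theorem weighted_degree_le (hreg : G.IsRegularOfDegree 3) (a : Vertex G X) :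
    ∑ i : Arc G X, weight i * (ind (src i = a) + ind (tgt i = a)) ≤ 12 := by
  rw [Fintype.sum_sum_type, Fintype.sum_sum_type]
  simp only [weight, src, tgt]
  have hdart : ∑ d : G.Dart, 2 * (ind (start X d = a) + ind (start X d.symm = a)) =
      4 * (Finset.univ.filter fun d : G.Dart => start X d = a).card := by
    have hsymm : ∑ d : G.Dart, ind (start X d.symm = a) = ∑ d : G.Dart, ind (start X d = a) :=
      Equiv.sum_comp (Function.Involutive.toPerm _ (Dart.symm_involutive (G := G)))
        fun d => ind (start X d = a)
    rw [← Finset.mul_sum, Finset.sum_add_distrib, hsymm, sum_ind]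
    ring
  rw [hdart]
  obtain v | p := a
  · have hn : ∀ p : Port G X, ind ((Sum.inr p : Vertex G X) = Sum.inl v) = 0 := by simp [ind]
    simp only [start_eq_inl, hn, add_zero, mul_zero, Finset.sum_const_zero, Sum.inl.injEq]
    rw [← Finset.mul_sum, sum_ind]
    by_cases hv : v ∈ X
    · simp [hv, card_ports_at hreg hv]
    · have h0 : (Finset.univ.filter fun p : Port G X => p.1.fst = v) = ∅ := by
        ext p
        simp only [Finset.mem_filter, Finset.mem_univ, true_and, Finset.notMem_empty, iff_false]
        rintro rfl
        exact hv p.2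
      simp [hv, h0, card_darts_at hreg]
  · have hn : ∀ v : V, ind ((Sum.inl v : Vertex G X) = Sum.inr p) = 0 := by simp [ind]
    have h1 : (Finset.univ.filter fun d : G.Dart => d = p.1).card = 1 := by
      simp [Finset.filter_eq']
    have h2 : (Finset.univ.filter fun q : Port G X => q ≠ p ∧ q.1.fst = p.1.fst).card = 2 := by
      have : (Finset.univ.filter fun q : Port G X => q ≠ p ∧ q.1.fst = p.1.fst) =
          (Finset.univ.filter fun q : Port G X => q.1.fst = p.1.fst).erase p := by
        ext q
        simp
      rw [this, Finset.card_erase_of_mem (by simp), card_ports_at hreg p.2]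
    have h3 : ∑ pq : Port G X × Port G X, ind (pq.1 ≠ pq.2 ∧ pq.1.1.fst = pq.2.1.fst) *
        (ind ((Sum.inr pq.1 : Vertex G X) = Sum.inr p) +
          ind ((Sum.inr pq.2 : Vertex G X) = Sum.inr p)) = 4 := by
      rw [Fintype.sum_prod_type]
      simp only [mul_add, Finset.sum_add_distrib]
      rw [Finset.sum_comm]
      have h4 : ∀ q : Port G X, ∑ r : Port G X, ind (r ≠ q ∧ r.1.fst = q.1.fst) *
          ind ((Sum.inr r : Vertex G X) = Sum.inr p) = ind (q ≠ p ∧ q.1.fst = p.1.fst) := by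
        intro q
        simp [ind, eq_comm]
      have h5 : ∀ q : Port G X, ∑ r : Port G X, ind (q ≠ r ∧ q.1.fst = r.1.fst) *
          ind ((Sum.inr r : Vertex G X) = Sum.inr p) = ind (q ≠ p ∧ q.1.fst = p.1.fst) := by
        intro q
        simp [ind]
      simp only [h4, h5]
      rw [sum_ind, h2]
    have h6 : (Finset.univ.filter fun q : Port G X => q = p).card = 1 := by
      simp [Finset.filter_eq']
    rw [h3]
    simp only [start_eq_inr, h1, hn, zero_add, Sum.inr.injEq]
    rw [← Finset.mul_sum, sum_ind, h6]
    norm_num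

theorem four_le_port_pairs (hreg : G.IsRegularOfDegree 3) (χ : Vertex G X → Prop)
    (hB : (Finset.univ.filter fun p : Port G X =>
      ¬(χ (Sum.inl p.1.fst) ↔ χ (Sum.inr p))).card ∈ Finset.Icc 1 2) :
    4 ≤ ∑ pq : Port G X × Port G X, ind (pq.1 ≠ pq.2 ∧ pq.1.1.fst = pq.2.1.fst) *
      ind ¬(χ (Sum.inr pq.1) ↔ χ (Sum.inr pq.2)) := by
  set B := Finset.univ.filter fun p : Port G X => ¬(χ (Sum.inl p.1.fst) ↔ χ (Sum.inr p)) with hBdef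
  rw [Finset.mem_Icc] at hB
  obtain ⟨p, hp⟩ := Finset.card_pos.1 hB.1
  set P := Finset.univ.filter fun q : Port G X => q.1.fst = p.1.fst with hP
  have hcard : (P ∩ B).card + (P \ B).card = 3 := by
    rw [Finset.card_inter_add_card_sdiff, card_ports_at hreg p.2]
  have hpos : 0 < (P ∩ B).card := Finset.card_pos.2 ⟨p, by simp [hp, hP]⟩
  have hle : (P ∩ B).card ≤ 2 := (Finset.card_le_card Finset.inter_subset_right).trans hB.2
  have hmul : 4 ≤ ((P ∩ B) ×ˢ (P \ B) ∪ (P \ B) ×ˢ (P ∩ B)).card := by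
    rw [Finset.card_union_of_disjoint, Finset.card_product, Finset.card_product]
    · have : (P \ B).card = 3 - (P ∩ B).card := by omega
      rw [this]
      interval_cases (P ∩ B).card <;> norm_num
    · rw [Finset.disjoint_left]
      rintro ⟨q, r⟩ h h'
      simp only [Finset.mem_product, Finset.mem_inter, Finset.mem_sdiff] at h h'
      exact h'.1.2 h.1.2
  have hsum : ∀ pq : Port G X × Port G X, ind (pq.1 ≠ pq.2 ∧ pq.1.1.fst = pq.2.1.fst) *
      ind (¬(χ (Sum.inr pq.1) ↔ χ (Sum.inr pq.2))) = ind ((pq.1 ≠ pq.2 ∧ pq.1.1.fst = pq.2.1.fst) ∧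
        ¬(χ (Sum.inr pq.1) ↔ χ (Sum.inr pq.2))) := by
    intro pq
    unfold ind
    split_ifs <;> simp_all
  simp only [hsum]
  rw [sum_ind]
  refine hmul.trans (Finset.card_le_card ?_)
  have hpair : ∀ q ∈ P ∩ B, ∀ r ∈ P \ B, (q ≠ r ∧ q.1.fst = r.1.fst) ∧
      ¬(χ (Sum.inr q) ↔ χ (Sum.inr r)) := by
    intro q hq r hr
    simp only [hP, hBdef, Finset.mem_inter, Finset.mem_sdiff, Finset.mem_filter, Finset.mem_univ,
      true_and, not_not] at hq hr
    refine ⟨⟨?_, hq.1.trans hr.1.symm⟩, ?_⟩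
    · rintro rfl
      exact hq.2 hr.2
    · have h1 := hq.2
      have h2 := hr.2
      rw [hq.1] at h1
      rw [hr.1] at h2
      tauto
  rintro ⟨q, r⟩ h
  rw [Finset.mem_union, Finset.mem_product, Finset.mem_product] at h
  rw [Finset.mem_filter]
  refine ⟨Finset.mem_univ _, ?_⟩
  obtain h | h := h
  · exact hpair q h.1 r h.2
  · have := hpair r h.2 q h.1
    exact ⟨⟨this.1.1.symm, this.1.2.symm⟩, fun h => this.2 h.symm⟩

theorem six_le_card_crossing (h3 : ThreeEdgeConnected G) (U : V → Prop) {x y : V}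
    (hx : U x) (hy : ¬ U y) :
    6 ≤ (Finset.univ.filter fun d : G.Dart => ¬(U d.fst ↔ U d.snd)).card := by
  have h1 := h3.three_le_card_boundary_s12 U hx hy
  have h2 := h3.three_le_card_boundary_s12 (fun v => ¬ U v) hy (not_not.2 hx)
  refine (Nat.add_le_add h1 h2).trans ?_
  rw [← Finset.card_union_of_disjoint]
  · refine Finset.card_le_card fun d hd => ?_
    simp only [Finset.mem_union, Finset.mem_filter, Finset.mem_univ, true_and] at hd ⊢
    tauto
  · rw [Finset.disjoint_left]
    intro d hd hd'
    simp only [Finset.mem_filter, Finset.mem_univ, true_and] at hd hd'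
    exact hd'.1 hd.1

/-- If exactly one port disagrees with its center, some edge of `G` still crosses. -/
theorem two_le_card_crossing_start (h3 : ThreeEdgeConnected G) (χ : Vertex G X → Prop)
    {p : Port G X} (hp : ¬(χ (Sum.inl p.1.fst) ↔ χ (Sum.inr p)))
    (huniq : ∀ q : Port G X, q ≠ p → (χ (Sum.inl q.1.fst) ↔ χ (Sum.inr q))) :
    2 ≤ (Finset.univ.filter fun d : G.Dart => ¬(χ (start X d) ↔ χ (start X d.symm))).card := by
  have hgood : ∀ d : G.Dart, d ≠ p.1 → (χ (start X d) ↔ χ (Sum.inl d.fst)) := by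
    intro d hd
    by_cases h : d.fst ∈ X
    · rw [start_of_mem h]
      exact (huniq ⟨d, h⟩ fun he => hd (congrArg Subtype.val he)).symm
    · rw [start_of_notMem h]
  obtain ⟨d, hd⟩ : ∃ d : G.Dart, ¬(χ (start X d) ↔ χ (start X d.symm)) := by
    by_cases hU : ∃ x y, χ (Sum.inl x) ∧ ¬ χ (Sum.inl y)
    · obtain ⟨x, y, hx, hy⟩ := hU
      have h6 := six_le_card_crossing h3 (fun v => χ (Sum.inl v)) hx hy
      obtain ⟨d, hd, hd'⟩ := Finset.exists_mem_notMem_of_card_lt_card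
        ((Finset.card_le_two (a := p.1) (b := p.1.symm)).trans_lt (lt_of_lt_of_le (by norm_num) h6))
      refine ⟨d, ?_⟩
      simp only [Finset.mem_insert, Finset.mem_singleton, not_or] at hd'
      rw [hgood d hd'.1, hgood d.symm fun h => hd'.2 (by rw [← h, Dart.symm_symm])]
      exact (Finset.mem_filter.1 hd).2
    · push Not at hU
      refine ⟨p.1, ?_⟩
      rw [start_eq_inr.2 rfl, hgood p.1.symm (Dart.symm_ne _)]
      have h1 := hU p.1.fst p.1.snd
      have h2 := hU p.1.snd p.1.fst
      have h3 : p.1.symm.fst = p.1.snd := rfl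
      rw [h3]
      tauto
  rw [← Finset.card_pair (Dart.symm_ne d)]
  refine Finset.card_le_card fun e he => ?_
  rw [Finset.mem_filter]
  refine ⟨Finset.mem_univ _, ?_⟩
  rw [Finset.mem_insert, Finset.mem_singleton] at he
  obtain rfl | rfl := he
  · rw [Dart.symm_symm]
    exact fun h => hd h.symm
  · exact hd

theorem twelve_le_cut (hreg : G.IsRegularOfDegree 3) (h3 : ThreeEdgeConnected G)
    (χ : Vertex G X → Prop) {a b : Vertex G X} (ha : χ a) (hb : ¬ χ b) :
    12 ≤ ∑ i : Arc G X, weight i * ind ¬(χ (src i) ↔ χ (tgt i)) := by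
  rw [Fintype.sum_sum_type, Fintype.sum_sum_type]
  simp only [weight, src, tgt]
  rw [← Finset.mul_sum, ← Finset.mul_sum, sum_ind, sum_ind]
  have hpp := four_le_port_pairs hreg χ
  rw [Finset.mem_Icc] at hpp
  set B := Finset.univ.filter fun p : Port G X => ¬(χ (Sum.inl p.1.fst) ↔ χ (Sum.inr p)) with hB
  obtain h0 | h1 | h2 | h3' : B.card = 0 ∨ B.card = 1 ∨ B.card = 2 ∨ 3 ≤ B.card := by omega
  · rw [Finset.card_eq_zero, Finset.filter_eq_empty_iff] at h0
    have hport : ∀ p : Port G X, χ (Sum.inl p.1.fst) ↔ χ (Sum.inr p) :=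
      fun p => not_not.1 (h0 (Finset.mem_univ p))
    have hstart : ∀ d : G.Dart, χ (start X d) ↔ χ (Sum.inl d.fst) := by
      intro d
      by_cases h : d.fst ∈ X
      · rw [start_of_mem h]
        exact (hport ⟨d, h⟩).symm
      · rw [start_of_notMem h]
    have hcenter : ∀ c : Vertex G X, ∃ v, χ (Sum.inl v) ↔ χ c := by
      rintro (v | p)
      · exact ⟨v, Iff.rfl⟩
      · exact ⟨p.1.fst, hport p⟩
    obtain ⟨x, hx⟩ := hcenter a
    obtain ⟨y, hy⟩ := hcenter b
    have := six_le_card_crossing h3 (fun v => χ (Sum.inl v)) (hx.2 ha) (fun h => hb (hy.1 h))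
    simp only [hstart]
    change 6 ≤ (Finset.univ.filter fun d : G.Dart =>
      ¬(χ (Sum.inl d.fst) ↔ χ (Sum.inl d.symm.fst))).card at this
    omega
  · have := hpp ⟨h1.ge, by omega⟩
    obtain ⟨p, hp⟩ := Finset.card_eq_one.1 h1
    have hmem : ∀ q : Port G X, ¬(χ (Sum.inl q.1.fst) ↔ χ (Sum.inr q)) ↔ q = p := by
      intro q
      have := Finset.ext_iff.1 hp q
      simpa [hB] using this
    have := two_le_card_crossing_start h3 χ ((hmem p).2 rfl)
      fun q hq => not_not.1 fun h => hq ((hmem q).1 h)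
    omega
  · have := hpp ⟨by omega, h2.le⟩
    omega
  · omega

theorem even_card_vertex (hreg : G.IsRegularOfDegree 3) (hX : Even X.card) :
    Even (Fintype.card (Vertex G X)) := by
  have hV : Even (Fintype.card V) := by
    have h := G.sum_degrees_eq_twice_card_edges
    rw [Finset.sum_congr rfl fun v _ => hreg.degree_eq v, Finset.sum_const, smul_eq_mul,
      Finset.card_univ] at h
    rw [Nat.even_iff]
    omega
  have hP : Fintype.card (Port G X) = X.card * 3 := by
    rw [← Finset.card_univ, Finset.card_eq_sum_card_fiberwise (f := fun p : Port G X => p.1.fst)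
      (t := X) fun p _ => p.2]
    rw [Finset.sum_congr rfl fun v hv => card_ports_at hreg hv, Finset.sum_const, smul_eq_mul]
  rw [Fintype.card_sum, hP]
  exact hV.add (hX.mul_right 3)

theorem exists_isPerfectMatching (hreg : G.IsRegularOfDegree 3) (h3 : ThreeEdgeConnected G)
    (hX : Even X.card) : ∃ M : (gadget G X).Subgraph, M.IsPerfectMatching := by
  refine exists_isPerfectMatching_of_arcs (gadget G X) src tgt weight 12 (by norm_num)
    (fun i hi => gadget_adj_of_weight_ne_zero hi) (weighted_degree_le hreg) fun C hC => ?_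
  obtain ⟨a, ha⟩ := Finset.card_pos.1 hC.pos
  obtain ⟨b, hb⟩ : ∃ b, b ∉ C := by
    by_contra! h
    rw [Finset.eq_univ_iff_forall.2 h, Finset.card_univ] at hC
    exact Nat.not_even_iff_odd.2 hC (even_card_vertex hreg hX)
  exact twelve_le_cut hreg h3 (· ∈ C) ha hb

variable (M : (gadget G X).Subgraph)

/-- The darts at `v` whose edge is used by `M`. -/
noncomputable def matchedDarts (v : V) : Finset G.Dart :=
  Finset.univ.filter fun d => d.fst = v ∧ M.Adj (start X d) (start X d.symm)

variable {M}

theorem mem_matchedDarts {v : V} {d : G.Dart} :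
    d ∈ matchedDarts M v ↔ d.fst = v ∧ M.Adj (start X d) (start X d.symm) := by
  simp [matchedDarts]

theorem card_matchedDarts_of_notMem (hM : M.IsPerfectMatching) {v : V} (hv : v ∉ X) :
    (matchedDarts M v).card = 1 := by
  rw [Subgraph.isPerfectMatching_iff] at hM
  obtain ⟨b, hb, huniq⟩ := hM (Sum.inl v)
  obtain ⟨d, rfl, rfl⟩ := gadget_adj_center_of_notMem hv hb.adj_sub
  rw [Finset.card_eq_one]
  refine ⟨d, ?_⟩
  ext e
  rw [mem_matchedDarts, Finset.mem_singleton]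
  constructor
  · rintro ⟨he, hadj⟩
    rw [start_of_notMem (he ▸ hv), he] at hadj
    have := fst_eq_of_start_eq (huniq _ hadj)
    exact Dart.ext _ _ (Prod.ext he this)
  · rintro rfl
    refine ⟨rfl, ?_⟩
    rwa [start_of_notMem hv]

theorem card_matchedDarts_of_mem (hreg : G.IsRegularOfDegree 3) (hM : M.IsPerfectMatching)
    {v : V} (hv : v ∈ X) : (matchedDarts M v).card = 0 ∨ (matchedDarts M v).card = 2 := by
  rw [Subgraph.isPerfectMatching_iff] at hM
  have huniq : ∀ {a b c}, M.Adj a b → M.Adj a c → b = c := fun h h' => (hM _).unique h h'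
  obtain ⟨b, hb⟩ := (hM (Sum.inl v)).exists
  obtain ⟨p₀, rfl, rfl⟩ := gadget_adj_center_of_mem hv hb.adj_sub
  set D := Finset.univ.filter fun d : G.Dart => d.fst = p₀.1.fst with hD
  have hDcard : D.card = 3 := card_darts_at hreg _
  have hp₀ : p₀.1 ∉ matchedDarts M p₀.1.fst := by
    rw [mem_matchedDarts, start_eq_inr.2 rfl]
    rintro ⟨-, h⟩
    exact p₀.1.adj.ne (start_eq_inl.1 (huniq h hb.symm)).1.symm
  have hsub : matchedDarts M p₀.1.fst ⊆ D.erase p₀.1 := by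
    intro d hd
    rw [Finset.mem_erase]
    refine ⟨fun h => hp₀ (h ▸ hd), ?_⟩
    simpa [hD] using (mem_matchedDarts.1 hd).1
  have hcard : (D.erase p₀.1).card = 2 := by
    rw [Finset.card_erase_of_mem (by simp [hD]), hDcard]
  obtain h | ⟨p, hp⟩ := (matchedDarts M p₀.1.fst).eq_empty_or_nonempty
  · exact Or.inl (Finset.card_eq_zero.2 h)
  refine Or.inr ?_
  rw [← hcard]
  refine congrArg _ (hsub.antisymm fun q hq => ?_)
  obtain ⟨hpv, hpadj⟩ := mem_matchedDarts.1 hp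
  obtain ⟨hqp₀, hqD⟩ := Finset.mem_erase.1 hq
  have hqv : q.fst = p₀.1.fst := by simpa [hD] using hqD
  by_cases hqp : q = p
  · rwa [hqp]
  have hqX : q.fst ∈ X := hqv ▸ p₀.2
  rw [mem_matchedDarts, start_of_mem hqX]
  refine ⟨hqv, ?_⟩
  obtain ⟨c, hc⟩ := (hM (Sum.inr ⟨q, hqX⟩)).exists
  obtain rfl | rfl | ⟨r, hqr, hrv, rfl⟩ := gadget_adj_port hc.adj_sub
  · have hcsymm := hc.symm
    rw [show (⟨q, hqX⟩ : Port G X).1.fst = p₀.1.fst from hqv] at hcsymm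
    exact absurd (congrArg Subtype.val (Sum.inr_injective (huniq hcsymm hb))) hqp₀
  · exact hc
  · have hr : r.1 ∈ ({p, p₀.1} : Finset G.Dart) := by
      have : ({p, p₀.1} : Finset G.Dart) = D.erase q := by
        refine Finset.eq_of_subset_of_card_le ?_ ?_
        · intro e he
          rw [Finset.mem_insert, Finset.mem_singleton] at he
          rw [Finset.mem_erase]
          obtain rfl | rfl := he
          · exact ⟨Ne.symm hqp, by simpa [hD] using hpv⟩
          · exact ⟨Ne.symm hqp₀, by simp [hD]⟩
        · rw [Finset.card_erase_of_mem hqD, hDcard, Finset.card_pair]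
          rintro rfl
          exact hp₀ hp
      rw [this, Finset.mem_erase]
      exact ⟨fun h => hqr (Subtype.ext h.symm), by simpa [hD] using hrv.symm.trans hqv⟩
    rw [Finset.mem_insert, Finset.mem_singleton] at hr
    obtain rfl | hr := hr
    · rw [start_eq_inr.2 rfl] at hpadj
      have := fst_eq_of_start_eq ((huniq hpadj hc.symm).trans (start_of_mem hqX).symm)
      exact absurd (this.trans (hqv.trans hpv.symm)).symm r.1.adj.ne
    · obtain rfl := Subtype.ext hr
      exact absurd (huniq hc.symm hb.symm) (by simp)

variable (M) in
/-- The subgraph of `G` formed by the edges that `M` does not use. -/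
def unmatched : SimpleGraph V where
  Adj u v := ∃ h : G.Adj u v, ¬ M.Adj (start X ⟨(u, v), h⟩) (start X (Dart.symm ⟨(u, v), h⟩))
  symm := ⟨fun _ _ ⟨h, h'⟩ => ⟨h.symm, fun hm => h' hm.symm⟩⟩
  loopless := ⟨fun _ ⟨h, _⟩ => h.ne rfl⟩

theorem degree_unmatched_add (hreg : G.IsRegularOfDegree 3) (v : V) :
    (unmatched M).degree v + (matchedDarts M v).card = 3 := by
  set D := Finset.univ.filter fun d : G.Dart => d.fst = v with hD
  have hsub : matchedDarts M v ⊆ D := by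
    intro d hd
    simpa [hD] using (mem_matchedDarts.1 hd).1
  have hdeg : (unmatched M).degree v = (D \ matchedDarts M v).card := by
    rw [← card_neighborFinset_eq_degree]
    symm
    refine Finset.card_bij (fun d _ => d.snd) ?_ ?_ ?_
    · rintro ⟨⟨u, w⟩, h⟩ hd
      rw [Finset.mem_sdiff, mem_matchedDarts, Finset.mem_filter] at hd
      obtain ⟨⟨-, hu⟩, hd⟩ := hd
      rw [mem_neighborFinset]
      cases hu
      exact ⟨h, fun h' => hd ⟨rfl, h'⟩⟩
    · intro d hd e he hde
      rw [Finset.mem_sdiff, Finset.mem_filter] at hd he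
      exact Dart.ext _ _ (Prod.ext (hd.1.2.trans he.1.2.symm) hde)
    · intro w hw
      rw [mem_neighborFinset] at hw
      obtain ⟨h, h'⟩ := hw
      refine ⟨⟨(v, w), h⟩, ?_, rfl⟩
      rw [Finset.mem_sdiff, mem_matchedDarts, Finset.mem_filter]
      exact ⟨⟨Finset.mem_univ _, rfl⟩, fun hm => h' hm.2⟩
  rw [hdeg, Finset.card_sdiff_add_card_eq_card hsub, card_darts_at hreg]

end ParityGadget

theorem cubic_three_edge_connected_strong_parity {V : Type*} [Fintype V] (G : SimpleGraph V)
    (hreg : G.IsRegularOfDegree 3) (h3 : ThreeEdgeConnected G) :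
    StrongParityProperty G := by
  intro X hX
  obtain ⟨M, hM⟩ := ParityGadget.exists_isPerfectMatching hreg h3 hX
  have hdeg := ParityGadget.degree_unmatched_add (M := M) hreg
  have hmem := fun v (hv : v ∈ X) => ParityGadget.card_matchedDarts_of_mem hreg hM hv
  have hnot := fun v (hv : v ∉ X) => ParityGadget.card_matchedDarts_of_notMem hM hv
  refine ⟨ParityGadget.unmatched M, fun _ _ h => h.1, fun v => ?_, fun v hv => ?_,
    fun v hv => ?_⟩
  · have := hdeg v
    by_cases hv : v ∈ X
    · have := hmem v hv
      omega
    · have := hnot v hv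
      omega
  · have := hdeg v
    have := hmem v hv
    rw [Nat.odd_iff]
    omega
  · have := hdeg v
    have := hnot v hv
    rw [Nat.even_iff]
    omega
end
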